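/- There exist ε > 0, η > 0, C > 0 and X₀ > 0 such that the following holds for every integer X ≥ X₀. Let H = ⌊10·X^{1−γ+η}/γ⌋. Then for all reals M, N, V ≥ 1 with X^{5−5γ+6ε+18η} ≤ M ≤ X^{γ−2ε−6η} and V ≤ H, and all complex coefficients a_m (m ∼ M) and d_h (h a nonzero integer with |h| ∼ V) of modulus at most 1, one has |S₂*| ≤ C·X^{1−2η}, where S₂* = Σ_{m ∼ M} Σ_{n ∼ N, mn ∼ X} Σ_{|h| ∼ V} a_m·d_h·e(h·(mn)^γ), the sums running over positive integers m, n and nonzero integers h in the indicated ranges. -/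

import Mathlib

open Finset

noncomputable def e (z : ℝ) : ℂ := Complex.exp (2 * Real.pi * Complex.I * z)

noncomputable def nint (x : ℝ) : ℝ := |x - round x|

noncomputable def dyN (Y : ℝ) : Finset ℕ :=
  (Finset.range (⌈Y⌉₊ + 1)).filter fun m => Y/2 ≤ (m:ℝ) ∧ (m:ℝ) < Y

noncomputable def dyZ (Y : ℝ) : Finset ℤ :=
  (Finset.Icc (-(⌈Y⌉₊:ℤ)) (⌈Y⌉₊:ℤ)).filter fun l => l ≠ 0 ∧ Y/2 ≤ |(l:ℝ)| ∧ |(l:ℝ)| < Y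

theorem e_add (x y : ℝ) : e (x + y) = e x * e y := by
  simp only [e]
  rw [← Complex.exp_add]
  push_cast
  ring_nf

theorem norm_e (x : ℝ) : ‖e x‖ = 1 := by
  have h : e x = Complex.exp ((2 * Real.pi * x : ℝ) * Complex.I) := by
    simp only [e]; push_cast; ring_nf
  rw [h, Complex.norm_exp_ofReal_mul_I]

theorem conj_e (x : ℝ) : (starRingEnd ℂ) (e x) = e (-x) := by
  simp only [e, ← Complex.exp_conj, map_mul, Complex.conj_ofReal, Complex.conj_I, map_ofNat]
  push_cast
  ring_nf

theorem e_intCast (k : ℤ) : e k = 1 := by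
  rw [e, Complex.exp_eq_one_iff]
  exact ⟨k, by push_cast; ring⟩

theorem one_sub_e_mul_cot {x : ℝ} (hx : Real.sin (Real.pi * x) ≠ 0) :
    (1 - e x) * (1 / 2 + Complex.I / 2 *
      ((Real.cos (Real.pi * x) / Real.sin (Real.pi * x) : ℝ) : ℂ)) = 1 := by
  have h : e x = (Real.cos (Real.pi * x) + Real.sin (Real.pi * x) * Complex.I) ^ 2 := by
    rw [Complex.ofReal_cos, Complex.ofReal_sin, ← Complex.exp_mul_I, ← Complex.exp_nat_mul, e]
    push_cast
    ring_nf
  have hs : (Real.sin (Real.pi * x) : ℂ) ≠ 0 := by exact_mod_cast hx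
  have hsc : (Real.sin (Real.pi * x) : ℂ) ^ 2 + (Real.cos (Real.pi * x) : ℂ) ^ 2 = 1 := by
    exact_mod_cast Real.sin_sq_add_cos_sq (Real.pi * x)
  rw [h]
  push_cast at *
  generalize Complex.sin (Real.pi * x) = s at *
  generalize Complex.cos (Real.pi * x) = c at *
  field_simp
  have hI : Complex.I ^ 2 = -1 := Complex.I_sq
  have hI3 : Complex.I ^ 3 = -Complex.I := by rw [pow_succ, hI]; ring
  ring_nf
  rw [hI, hI3]
  linear_combination (s - Complex.I * c) * hsc

theorem two_mul_le_sin_pi_mul {θ x : ℝ} (hθ : 0 < θ) (h1 : θ ≤ x) (h2 : x ≤ 1 - θ) :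
    2 * θ ≤ Real.sin (Real.pi * x) := by
  have hpi := Real.pi_pos
  rcases le_total x (1 / 2) with h | h
  · have := Real.mul_le_sin (x := Real.pi * x) (mul_nonneg hpi.le (by linarith))
      (by nlinarith)
    have e1 : 2 / Real.pi * (Real.pi * x) = 2 * x := by field_simp
    linarith
  · have := Real.mul_le_sin (x := Real.pi * (1 - x)) (by nlinarith) (by nlinarith)
    have e1 : 2 / Real.pi * (Real.pi * (1 - x)) = 2 * (1 - x) := by field_simp
    have e2 : Real.sin (Real.pi * (1 - x)) = Real.sin (Real.pi * x) := by
      rw [← Real.sin_pi_sub]; ring_nf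
    linarith

theorem cot_pi_mul_antitone {x y : ℝ} (hx : 0 < x) (hxy : x ≤ y) (hy : y < 1) :
    Real.cos (Real.pi * y) / Real.sin (Real.pi * y) ≤
      Real.cos (Real.pi * x) / Real.sin (Real.pi * x) := by
  have hpi := Real.pi_pos
  rw [div_le_div_iff₀ (Real.sin_pos_of_pos_of_lt_pi (by nlinarith) (by nlinarith))
    (Real.sin_pos_of_pos_of_lt_pi (by nlinarith) (by nlinarith))]
  have := Real.sin_nonneg_of_nonneg_of_le_pi (x := Real.pi * y - Real.pi * x)
    (by nlinarith) (by nlinarith)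
  rw [Real.sin_sub] at this
  linarith

/-- Abel summation against an antitone weight. -/
theorem norm_sum_antitone_mul_sub_le (t : ℕ → ℝ) (E : ℕ → ℂ) (hE : ∀ n, ‖E n‖ ≤ 1) (L : ℕ)
    (ht : ∀ n < L, t (n + 1) ≤ t n) :
    ‖∑ n ∈ range (L + 1), (t n : ℂ) * (E n - E (n + 1)) + t L * E (L + 1)‖ ≤
      |t 0| + (t 0 - t L) := by
  induction L with
  | zero =>
    simp only [zero_add, sum_range_one, sub_self, add_zero]
    have : (t 0 : ℂ) * (E 0 - E 1) + t 0 * E 1 = t 0 * E 0 := by ring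
    rw [this, norm_mul, Complex.norm_real, Real.norm_eq_abs]
    exact mul_le_of_le_one_right (abs_nonneg _) (hE 0)
  | succ L ih =>
    have ih' := ih fun n hn => ht n (by omega)
    rw [sum_range_succ]
    have h1 : ∑ n ∈ range (L + 1), (t n : ℂ) * (E n - E (n + 1)) +
        t (L + 1) * (E (L + 1) - E (L + 1 + 1)) + t (L + 1) * E (L + 1 + 1) =
        (∑ n ∈ range (L + 1), (t n : ℂ) * (E n - E (n + 1)) + t L * E (L + 1)) +
          ((t (L + 1) - t L : ℝ) : ℂ) * E (L + 1) := by push_cast; ring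
    rw [h1]
    have h2 : ‖((t (L + 1) - t L : ℝ) : ℂ) * E (L + 1)‖ ≤ t L - t (L + 1) := by
      rw [norm_mul, Complex.norm_real, Real.norm_eq_abs,
        abs_of_nonpos (by linarith [ht L (by omega)])]
      have := ht L (by omega)
      nlinarith [hE (L + 1), norm_nonneg (E (L + 1))]
    refine (norm_add_le _ _).trans ?_
    linarith

/-- The Kusmin–Landau inequality, with differences in `[θ, 1 - θ]`. -/
theorem kusmin_landau_range (u : ℕ → ℝ) (L : ℕ) {θ : ℝ} (hθ : 0 < θ) (hθ1 : θ ≤ 1)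
    (hδ : ∀ n < L, θ ≤ u (n + 1) - u n ∧ u (n + 1) - u n ≤ 1 - θ)
    (hmono : ∀ n, n + 1 < L → u (n + 1) - u n ≤ u (n + 2) - u (n + 1)) :
    ‖∑ n ∈ range L, e (u n)‖ ≤ 3 / θ := by
  rcases L with _ | L
  · simp; positivity
  set t : ℕ → ℝ := fun n => Real.cos (Real.pi * (u (n + 1) - u n)) /
    Real.sin (Real.pi * (u (n + 1) - u n)) with ht
  have hsin : ∀ n < L + 1, 2 * θ ≤ Real.sin (Real.pi * (u (n + 1) - u n)) := fun n hn =>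
    two_mul_le_sin_pi_mul hθ (hδ n hn).1 (hδ n hn).2
  have habs : ∀ n < L + 1, |t n| ≤ 1 / (2 * θ) := by
    intro n hn
    have h := hsin n hn
    rw [ht]
    simp only
    rw [abs_div, abs_of_pos (by linarith : 0 < Real.sin (Real.pi * (u (n + 1) - u n)))]
    exact div_le_div₀ zero_le_one (Real.abs_cos_le_one _) (by positivity) h
  have hanti : ∀ n < L, t (n + 1) ≤ t n := fun n hn =>
    cot_pi_mul_antitone (by linarith [(hδ n (by omega)).1]) (hmono n (by omega))
      (by linarith [(hδ (n + 1) (by omega)).2])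
  have hA := norm_sum_antitone_mul_sub_le t (fun n => e (u n)) (fun n => (norm_e _).le) L hanti
  have hterm : ∀ n ∈ range (L + 1), e (u n) =
      1 / 2 * (e (u n) - e (u (n + 1))) +
        Complex.I / 2 * ((t n : ℂ) * (e (u n) - e (u (n + 1)))) := by
    intro n hn
    have h := one_sub_e_mul_cot (x := u (n + 1) - u n)
      (by have := hsin n (mem_range.1 hn); linarith)
    have h2 : e (u (n + 1)) = e (u n) * e (u (n + 1) - u n) := by
      rw [← e_add]; congr 1; ring
    rw [h2]
    linear_combination (-e (u n)) * h
  rw [sum_congr rfl hterm, sum_add_distrib, ← mul_sum, ← mul_sum, sum_range_sub']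
  have e1 : ∑ n ∈ range (L + 1), (t n : ℂ) * (e (u n) - e (u (n + 1))) =
      (∑ n ∈ range (L + 1), (t n : ℂ) * (e (u n) - e (u (n + 1))) + t L * e (u (L + 1))) -
        t L * e (u (L + 1)) := by ring
  have hT : ‖(t L : ℂ) * e (u (L + 1))‖ ≤ 1 / (2 * θ) := by
    rw [norm_mul, norm_e, mul_one, Complex.norm_real]
    exact habs L (by omega)
  have b1 : ‖∑ n ∈ range (L + 1), (t n : ℂ) * (e (u n) - e (u (n + 1)))‖ ≤ 4 * (1 / (2 * θ)) := by
    rw [e1]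
    refine (norm_sub_le _ _).trans ?_
    have h0 := habs 0 (by omega)
    have hL := habs L (by omega)
    have := abs_le.1 h0
    have := abs_le.1 hL
    linarith
  have b2 : ‖e (u 0) - e (u (L + 1))‖ ≤ 2 := by
    refine (norm_sub_le _ _).trans ?_
    rw [norm_e, norm_e]; norm_num
  refine (norm_add_le _ _).trans ?_
  rw [norm_mul, norm_mul]
  have n1 : ‖(1 / 2 : ℂ)‖ = 1 / 2 := by norm_num
  have n2 : ‖Complex.I / 2‖ = 1 / 2 := by simp
  rw [n1, n2]
  have e3 : 3 / θ = 1 / θ + 4 * (1 / (2 * θ)) := by field_simp; norm_num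
  have : 1 ≤ 1 / θ := by rw [le_div_iff₀ hθ]; linarith
  have : 0 < 1 / (2 * θ) := by positivity
  linarith

theorem kusmin_landau (u : ℕ → ℝ) (p q : ℕ) (k : ℤ) {θ : ℝ} (hθ : 0 < θ) (hθ1 : θ ≤ 1)
    (hδ : ∀ n ∈ Ico p q, k + θ ≤ u (n + 1) - u n ∧ u (n + 1) - u n ≤ k + 1 - θ)
    (hmono : ∀ n ∈ Ico p q, u (n + 1) - u n ≤ u (n + 2) - u (n + 1)) :
    ‖∑ n ∈ Ico p q, e (u n)‖ ≤ 3 / θ := by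
  have h := kusmin_landau_range (fun n => u (p + n) - k * n) (q - p) hθ hθ1
    (by
      intro n hn
      have := hδ (p + n) (by rw [mem_Ico]; omega)
      have e1 : p + (n + 1) = p + n + 1 := by ring
      simp only [e1]
      push_cast
      constructor <;> linarith [this.1, this.2])
    (by
      intro n hn
      have := hmono (p + n) (by rw [mem_Ico]; omega)
      have e1 : p + (n + 1) = p + n + 1 := by ring
      have e2 : p + (n + 2) = p + n + 2 := by ring
      simp only [e1, e2]
      push_cast
      linarith)
  rw [sum_Ico_eq_sum_range]
  convert h using 3 with n hn
  have : u (p + n) = (u (p + n) - k * n) + ((k * n : ℤ) : ℝ) := by push_cast; ring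
  rw [this, e_add, e_intCast, mul_one]
  simp

theorem card_le_of_spaced {ι : Type*} (s : Finset ι) (f : ι → ℝ) {σ L t : ℝ} (hσ : 0 < σ)
    (hL : 0 ≤ L) (hsp : ∀ i ∈ s, ∀ j ∈ s, i ≠ j → σ ≤ |f i - f j|)
    (hf : ∀ i ∈ s, t ≤ f i ∧ f i ≤ t + L) : (#s : ℝ) ≤ L / σ + 1 := by
  have hmaps : ∀ i ∈ s, ⌊(f i - t) / σ⌋₊ ∈ range (⌊L / σ⌋₊ + 1) := by
    intro i hi
    rw [mem_range, Nat.lt_succ_iff]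
    apply Nat.floor_le_floor
    have := (hf i hi).2
    gcongr
    linarith
  have hinj : ∀ i ∈ s, ∀ j ∈ s, ⌊(f i - t) / σ⌋₊ = ⌊(f j - t) / σ⌋₊ → i = j := by
    intro i hi j hj hij
    by_contra hne
    have h := hsp i hi j hj hne
    have pi : 0 ≤ (f i - t) / σ := div_nonneg (by linarith [(hf i hi).1]) hσ.le
    have pj : 0 ≤ (f j - t) / σ := div_nonneg (by linarith [(hf j hj).1]) hσ.le
    have a1 := Nat.floor_le pi
    have a2 := Nat.lt_floor_add_one ((f i - t) / σ)
    have a3 := Nat.floor_le pj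
    have a4 := Nat.lt_floor_add_one ((f j - t) / σ)
    rw [hij] at a1 a2
    have h2 : |(f i - t) / σ - (f j - t) / σ| < 1 := by rw [abs_lt]; constructor <;> linarith
    have h3 : (f i - t) / σ - (f j - t) / σ = (f i - f j) / σ := by ring
    rw [h3, abs_div, abs_of_pos hσ, div_lt_one hσ] at h2
    linarith
  have hc := card_le_card_of_injOn _ hmaps (fun i hi j hj => hinj i hi j hj)
  rw [card_range] at hc
  have : (#s : ℝ) ≤ (⌊L / σ⌋₊ : ℝ) + 1 := by exact_mod_cast hc
  linarith [Nat.floor_le (div_nonneg hL hσ.le)]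

theorem exists_eq_Ico_of_ordConnected (s : Finset ℕ)
    (h : ∀ a ∈ s, ∀ b ∈ s, ∀ x, a ≤ x → x ≤ b → x ∈ s) : ∃ p q, s = Ico p q := by
  rcases s.eq_empty_or_nonempty with rfl | hs
  · exact ⟨0, 0, by simp⟩
  · refine ⟨s.min' hs, s.max' hs + 1, ?_⟩
    ext x
    rw [mem_Ico]
    exact ⟨fun hx => ⟨s.min'_le x hx, Nat.lt_succ_of_le (s.le_max' x hx)⟩, fun hx =>
      h _ (s.min'_mem hs) _ (s.max'_mem hs) x hx.1 (Nat.le_of_lt_succ hx.2)⟩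

/-- Second derivative test: in terms of second differences of size between `lam` and `α * lam`. -/
theorem norm_sum_e_le_of_second_diff (u : ℕ → ℝ) (a b : ℕ) {lam α : ℝ} (hlam : 0 < lam)
    (hα : 1 ≤ α) (h : ∀ n ∈ Ico a b, lam ≤ u (n + 2) - 2 * u (n + 1) + u n ∧
      u (n + 2) - 2 * u (n + 1) + u n ≤ α * lam) :
    ‖∑ n ∈ Ico a b, e (u n)‖ ≤
      14 * α * (#(Ico a b) * Real.sqrt lam + 1 / Real.sqrt lam) := by
  set θ := Real.sqrt lam with hθdef
  have hθ : 0 < θ := Real.sqrt_pos.2 hlam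
  have hθ2 : θ * θ = lam := Real.mul_self_sqrt hlam.le
  have hcard0 : (0 : ℝ) ≤ #(Ico a b) := Nat.cast_nonneg _
  have htriv : ‖∑ n ∈ Ico a b, e (u n)‖ ≤ #(Ico a b) := by
    refine (norm_sum_le _ _).trans ?_
    simp [norm_e]
  have hinv : 0 < 1 / θ := by positivity
  rcases lt_or_ge 1 θ with h1 | h1
  · refine htriv.trans ?_
    have : (#(Ico a b) : ℝ) ≤ #(Ico a b) * θ := le_mul_of_one_le_right hcard0 h1.le
    nlinarith [mul_nonneg hcard0 hθ.le]
  rcases le_or_gt b a with hab | hab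
  · rw [Ico_eq_empty_of_le hab]
    simp
    positivity
  set D : ℕ → ℝ := fun n => u (n + 1) - u n with hD
  have hstep : ∀ j n, n ∈ Ico a b → n + j ∈ Ico a b →
      lam * j ≤ D (n + j) - D n ∧ D (n + j) - D n ≤ α * lam * j := by
    intro j
    induction j with
    | zero => intro n _ _; simp
    | succ j ih =>
      intro n hn hj
      rw [mem_Ico] at hn hj
      have h0 := ih n (mem_Ico.2 hn) (mem_Ico.2 (by omega))
      have h2 := h (n + j) (mem_Ico.2 (by omega))
      have e1 : D (n + (j + 1)) = u (n + j + 2) - u (n + j + 1) := by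
        simp only [hD]; ring_nf
      have e2 : D (n + j) = u (n + j + 1) - u (n + j) := rfl
      push_cast
      rw [e1]
      constructor <;> linarith [h0.1, h0.2, h2.1, h2.2]
  have hstep' : ∀ n ∈ Ico a b, ∀ m ∈ Ico a b, n ≤ m →
      lam * ((m : ℝ) - n) ≤ D m - D n ∧ D m - D n ≤ α * lam * ((m : ℝ) - n) := by
    intro n hn m hm hnm
    obtain ⟨j, rfl⟩ := Nat.exists_eq_add_of_le hnm
    have := hstep j n hn hm
    push_cast
    rwa [add_sub_cancel_left]
  have hmono : ∀ n ∈ Ico a b, ∀ m ∈ Ico a b, n ≤ m → D n ≤ D m := by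
    intro n hn m hm hnm
    have h0 := (hstep' n hn m hm hnm).1
    have : (n : ℝ) ≤ m := by exact_mod_cast hnm
    nlinarith
  have hspaced : ∀ n ∈ Ico a b, ∀ m ∈ Ico a b, n ≠ m → lam ≤ |D n - D m| := by
    intro n hn m hm hne
    rcases lt_or_gt_of_ne hne with hlt | hlt
    · have h0 := (hstep' n hn m hm hlt.le).1
      have : (n : ℝ) + 1 ≤ m := by exact_mod_cast hlt
      rw [abs_sub_comm]
      exact le_trans (by nlinarith) (le_abs_self _)
    · have h0 := (hstep' m hm n hn hlt.le).1
      have : (m : ℝ) + 1 ≤ n := by exact_mod_cast hlt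
      exact le_trans (by nlinarith) (le_abs_self _)
  have hnear : ∀ t : ℝ, (#{n ∈ Ico a b | t ≤ D n ∧ D n ≤ t + θ} : ℝ) ≤ 2 / θ := by
    intro t
    have h0 := card_le_of_spaced {n ∈ Ico a b | t ≤ D n ∧ D n ≤ t + θ} D hlam hθ.le
      (fun i hi j hj => hspaced i (mem_filter.1 hi).1 j (mem_filter.1 hj).1)
      (fun i hi => (mem_filter.1 hi).2)
    have e1 : θ / lam = 1 / θ := by rw [← hθ2]; field_simp
    have e2 : 1 ≤ 1 / θ := by rwa [le_div_iff₀ hθ, one_mul]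
    have e3 : 2 / θ = 1 / θ + 1 / θ := by ring
    linarith
  have hblock : ∀ k : ℤ, ‖∑ n ∈ Ico a b with ⌊D n⌋ = k, e (u n)‖ ≤ 7 / θ := by
    intro k
    set F := {n ∈ Ico a b | ⌊D n⌋ = k} with hF
    rw [← sum_filter_add_sum_filter_not F (fun n => k + θ ≤ D n ∧ D n ≤ k + 1 - θ)]
    have hmid : ‖∑ n ∈ F with k + θ ≤ D n ∧ D n ≤ k + 1 - θ, e (u n)‖ ≤ 3 / θ := by
      obtain ⟨p, q, hpq⟩ := exists_eq_Ico_of_ordConnected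
        {n ∈ F | k + θ ≤ D n ∧ D n ≤ k + 1 - θ} (by
          intro x hx y hy z hxz hzy
          simp only [hF, mem_filter, Int.floor_eq_iff] at hx hy ⊢
          have hz : z ∈ Ico a b := by
            have h1 := mem_Ico.1 hx.1.1
            have h2 := mem_Ico.1 hy.1.1
            rw [mem_Ico]; omega
          have h1 := hmono x hx.1.1 z hz hxz
          have h2 := hmono z hz y hy.1.1 hzy
          refine ⟨⟨hz, ?_, ?_⟩, ?_, ?_⟩ <;> linarith [hx.1.2.1, hx.2.1, hy.1.2.2, hy.2.2])
      rw [hpq]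
      refine kusmin_landau u p q k hθ h1 ?_ ?_
      · intro n hn
        rw [← hpq] at hn
        exact (mem_filter.1 hn).2
      · intro n hn
        rw [← hpq] at hn
        have := (h n (mem_filter.1 (mem_filter.1 hn).1).1).1
        linarith
    have hrest : ‖∑ n ∈ F with ¬(k + θ ≤ D n ∧ D n ≤ k + 1 - θ), e (u n)‖ ≤ 2 / θ + 2 / θ := by
      refine (norm_sum_le _ _).trans ?_
      simp only [norm_e, sum_const, nsmul_eq_mul, mul_one]
      refine le_trans ?_ (add_le_add (hnear k) (hnear (k + 1 - θ)))
      rw [← Nat.cast_add, Nat.cast_le]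
      refine le_trans (card_le_card ?_) (card_union_le _ _)
      intro n hn
      simp only [hF, mem_filter, mem_union, Int.floor_eq_iff] at hn ⊢
      obtain ⟨⟨hn1, hn2, hn3⟩, hn4⟩ := hn
      by_cases hc : k + θ ≤ D n
      · right
        have : ¬ D n ≤ k + 1 - θ := fun h' => hn4 ⟨hc, h'⟩
        exact ⟨hn1, by linarith, by linarith⟩
      · left
        exact ⟨hn1, by linarith, by linarith⟩
    refine (norm_add_le _ _).trans ?_
    have : 7 / θ = 3 / θ + (2 / θ + 2 / θ) := by ring
    linarith
  have ha : a ∈ Ico a b := mem_Ico.2 ⟨le_rfl, hab⟩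
  have hb : b - 1 ∈ Ico a b := mem_Ico.2 ⟨by omega, by omega⟩
  rw [← sum_fiberwise_of_maps_to (t := Icc ⌊D a⌋ ⌊D (b - 1)⌋) (g := fun n => ⌊D n⌋)
    (by
      intro n hn
      have hn' := mem_Ico.1 hn
      rw [mem_Icc]
      exact ⟨Int.floor_le_floor (hmono a ha n hn hn'.1),
        Int.floor_le_floor (hmono n hn _ hb (by omega))⟩)]
  refine (norm_sum_le _ _).trans ((sum_le_sum fun k _ => hblock k).trans ?_)
  rw [sum_const, nsmul_eq_mul, Int.card_Icc]
  have hle : ⌊D a⌋ ≤ ⌊D (b - 1)⌋ := Int.floor_le_floor (hmono a ha _ hb (by omega))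
  have hcast : (((⌊D (b - 1)⌋ + 1 - ⌊D a⌋).toNat : ℕ) : ℝ) = ⌊D (b - 1)⌋ + 1 - ⌊D a⌋ := by
    have : (((⌊D (b - 1)⌋ + 1 - ⌊D a⌋).toNat : ℤ)) = ⌊D (b - 1)⌋ + 1 - ⌊D a⌋ :=
      Int.toNat_of_nonneg (by omega)
    exact_mod_cast this
  have hnum : (((⌊D (b - 1)⌋ + 1 - ⌊D a⌋).toNat : ℕ) : ℝ) ≤ α * lam * #(Ico a b) + 2 := by
    rw [hcast]
    have h1 := Int.floor_le (D (b - 1))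
    have h2 := Int.lt_floor_add_one (D a)
    have h3 := (hstep' a ha _ hb (by omega)).2
    have h4 : ((b - 1 : ℕ) : ℝ) - a ≤ #(Ico a b) := by
      rw [Nat.card_Ico, Nat.cast_sub (by omega), Nat.cast_sub (by omega)]
      push_cast; linarith
    have h5 : α * lam * (((b - 1 : ℕ) : ℝ) - a) ≤ α * lam * #(Ico a b) :=
      mul_le_mul_of_nonneg_left h4 (by positivity)
    linarith
  calc _ ≤ (α * lam * #(Ico a b) + 2) * (7 / θ) :=
        mul_le_mul_of_nonneg_right hnum (by positivity)
    _ = 7 * α * (#(Ico a b) * θ) + 14 * (1 / θ) := by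
        rw [← hθ2]; field_simp; ring
    _ ≤ _ := by
        have h1 : 0 ≤ α * (#(Ico a b) * θ) := by positivity
        have h2 : 1 / θ ≤ α * (1 / θ) := le_mul_of_one_le_left hinv.le hα
        linarith

theorem exists_second_diff_rpow_eq {γ x : ℝ} (hx : 0 < x) :
    ∃ ζ, x < ζ ∧ ζ < x + 2 ∧
      2 * (x + 1) ^ γ - x ^ γ - (x + 2) ^ γ = γ * (1 - γ) * ζ ^ (γ - 2) := by
  have hd : ∀ (p y : ℝ), 0 < y → HasDerivAt (fun z : ℝ => (z + 1) ^ p - z ^ p)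
      (p * (y + 1) ^ (p - 1) - p * y ^ (p - 1)) y := by
    intro p y hy
    have h1 : HasDerivAt (fun z : ℝ => (z + 1) ^ p) (p * (y + 1) ^ (p - 1)) y := by
      simpa using ((hasDerivAt_id y).add_const 1).rpow_const (p := p)
        (Or.inl (by simp; linarith))
    exact h1.sub (Real.hasDerivAt_rpow_const (Or.inl hy.ne'))
  obtain ⟨ξ, hξ, hξe⟩ := exists_hasDerivAt_eq_slope (fun z : ℝ => (z + 1) ^ γ - z ^ γ)
    (fun y => γ * (y + 1) ^ (γ - 1) - γ * y ^ (γ - 1)) (show x < x + 1 by linarith)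
    (fun y hy => (hd γ y (by linarith [hy.1])).continuousAt.continuousWithinAt)
    (fun y hy => hd γ y (by linarith [hy.1]))
  have hξ0 : 0 < ξ := by linarith [hξ.1]
  obtain ⟨ζ, hζ, hζe⟩ := exists_hasDerivAt_eq_slope (fun z : ℝ => z ^ (γ - 1))
    (fun y => (γ - 1) * y ^ (γ - 1 - 1)) (show ξ < ξ + 1 by linarith)
    (fun y hy => (Real.hasDerivAt_rpow_const
      (Or.inl (hξ0.trans_le hy.1).ne')).continuousAt.continuousWithinAt)
    (fun y hy => Real.hasDerivAt_rpow_const (Or.inl (hξ0.trans hy.1).ne'))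
  refine ⟨ζ, hξ.1.trans hζ.1, by linarith [hξ.2, hζ.2], ?_⟩
  simp only [add_sub_cancel_left, div_one] at hξe hζe
  have e1 : γ - 1 - 1 = γ - 2 := by ring
  have e2 : x + 1 + 1 = x + 2 := by ring
  rw [e1] at hζe
  rw [e2] at hξe
  linear_combination hξe + γ * hζe

theorem norm_sum_e_rpow_le {γ A M : ℝ} (hγ0 : 0 < γ) (hγ1 : γ < 1) (hA : 0 < A) (hM : 1 ≤ M)
    (s : Finset ℕ) (hs : ∀ m ∈ s, M / 2 ≤ (m : ℝ) ∧ (m : ℝ) < M)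
    (hc : ∀ a ∈ s, ∀ b ∈ s, ∀ x, a ≤ x → x ≤ b → x ∈ s) :
    ‖∑ m ∈ s, e (A * (m : ℝ) ^ γ)‖ ≤ 504 * (1 + 3 / Real.sqrt (γ * (1 - γ))) *
      (#s * Real.sqrt (A * M ^ (γ - 2)) + 1 / Real.sqrt (A * M ^ (γ - 2))) := by
  obtain ⟨p, q, rfl⟩ := exists_eq_Ico_of_ordConnected s hc
  have hM0 : 0 < M := by linarith
  have hg : 0 < γ * (1 - γ) := mul_pos hγ0 (by linarith)
  set P := M ^ (γ - 2) with hP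
  have hP0 : 0 < P := Real.rpow_pos_of_pos hM0 _
  have hnorm : ‖∑ m ∈ Ico p q, e (A * (m : ℝ) ^ γ)‖ = ‖∑ m ∈ Ico p q, e (-(A * (m : ℝ) ^ γ))‖ := by
    rw [← RCLike.norm_conj, map_sum]
    simp only [conj_e]
  have hl : 1 / 9 * P ≤ (3 * M) ^ (γ - 2) := by
    rw [Real.mul_rpow (by norm_num) hM0.le]
    gcongr
    calc (1 / 9 : ℝ) = 3 ^ (-2 : ℝ) := by
          rw [Real.rpow_neg (by norm_num)]; norm_num
      _ ≤ _ := Real.rpow_le_rpow_of_exponent_le (by norm_num) (by linarith)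
  have hu : (M / 2) ^ (γ - 2) ≤ 4 * P := by
    rw [Real.div_rpow hM0.le (by norm_num), ← hP, div_eq_mul_inv, mul_comm,
      ← Real.rpow_neg (by norm_num)]
    gcongr
    calc (2 : ℝ) ^ (-(γ - 2)) ≤ 2 ^ (2 : ℝ) :=
          Real.rpow_le_rpow_of_exponent_le (by norm_num) (by linarith)
      _ = 4 := by norm_num
  have key := norm_sum_e_le_of_second_diff (fun m => -(A * (m : ℝ) ^ γ)) p q
    (lam := γ * (1 - γ) / 9 * (A * P)) (α := 36) (by positivity) (by norm_num) (by
      intro n hn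
      obtain ⟨h1, h2⟩ := hs n hn
      have hn0 : (0 : ℝ) < n := by linarith
      obtain ⟨ζ, hζ1, hζ2, hζ⟩ := exists_second_diff_rpow_eq (γ := γ) hn0
      have b1 : (3 * M) ^ (γ - 2) ≤ ζ ^ (γ - 2) :=
        Real.rpow_le_rpow_of_nonpos (by linarith) (by linarith) (by linarith)
      have b2 : ζ ^ (γ - 2) ≤ (M / 2) ^ (γ - 2) :=
        Real.rpow_le_rpow_of_nonpos (by linarith) (by linarith) (by linarith)
      have e1 : -(A * ((n + 2 : ℕ) : ℝ) ^ γ) - 2 * -(A * ((n + 1 : ℕ) : ℝ) ^ γ) +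
          -(A * (n : ℝ) ^ γ) = γ * (1 - γ) * A * ζ ^ (γ - 2) := by
        push_cast
        linear_combination A * hζ
      rw [e1]
      have hgA : 0 < γ * (1 - γ) * A := by positivity
      constructor
      · have := mul_le_mul_of_nonneg_left (hl.trans b1) hgA.le
        linarith
      · have := mul_le_mul_of_nonneg_left (b2.trans hu) hgA.le
        linarith)
  rw [hnorm]
  refine key.trans ?_
  have hAP : 0 < A * P := by positivity
  set r := Real.sqrt (A * P) with hr
  set g := Real.sqrt (γ * (1 - γ)) with hgd
  have hr0 : 0 < r := Real.sqrt_pos.2 hAP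
  have hg0 : 0 < g := Real.sqrt_pos.2 hg
  have hsq : Real.sqrt (γ * (1 - γ) / 9 * (A * P)) = g / 3 * r := by
    rw [Real.sqrt_mul (by positivity), Real.sqrt_div hg.le]
    congr 2
    rw [show (9 : ℝ) = 3 ^ 2 by norm_num, Real.sqrt_sq (by norm_num)]
  have hg1 : g ≤ 1 := by
    rw [hgd, Real.sqrt_le_iff]
    refine ⟨zero_le_one, ?_⟩
    nlinarith
  rw [hsq]
  have e2 : 1 / (g / 3 * r) = 3 / g * (1 / r) := by field_simp
  rw [e2]
  have hcn : (0 : ℝ) ≤ #(Ico p q) := Nat.cast_nonneg _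
  have t1 : (#(Ico p q) : ℝ) * (g / 3 * r) ≤ #(Ico p q) * r := by
    apply mul_le_mul_of_nonneg_left _ hcn
    nlinarith
  have : 0 ≤ 3 / g := by positivity
  have : 0 < 1 / r := by positivity
  have : 0 ≤ 3 / g * (#(Ico p q) * r) := by positivity
  nlinarith

theorem card_filter_product_le_left {α β : Type*} (s : Finset α) (t : Finset β)
    (P : α → β → Prop) [∀ a b, Decidable (P a b)] {B : ℝ}
    (h : ∀ a ∈ s, (#{b ∈ t | P a b} : ℝ) ≤ B) :
    (#{x ∈ s ×ˢ t | P x.1 x.2} : ℝ) ≤ #s * B := by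
  have : #{x ∈ s ×ˢ t | P x.1 x.2} = ∑ a ∈ s, #{b ∈ t | P a b} := by
    simp only [card_filter, sum_product]
  rw [this]
  push_cast
  refine (sum_le_sum h).trans ?_
  simp

theorem card_filter_product_le_right {α β : Type*} (s : Finset α) (t : Finset β)
    (P : α → β → Prop) [∀ a b, Decidable (P a b)] {B : ℝ}
    (h : ∀ b ∈ t, (#{a ∈ s | P a b} : ℝ) ≤ B) :
    (#{x ∈ s ×ˢ t | P x.1 x.2} : ℝ) ≤ #t * B := by
  have : #{x ∈ s ×ˢ t | P x.1 x.2} = ∑ b ∈ t, #{a ∈ s | P a b} := by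
    simp only [card_filter, sum_product_right]
  rw [this]
  push_cast
  refine (sum_le_sum h).trans ?_
  simp

/-- Pairs of integers in `[1, H]` with greatest common divisor `g`. -/
def gcdPairs (H g : ℕ) : Finset (ℕ × ℕ) :=
  (Icc 1 H ×ˢ Icc 1 H).filter fun p => Nat.gcd p.1 p.2 = g

/-- The logarithm of the ratio of a pair. -/
noncomputable def logRatio (p : ℕ × ℕ) : ℝ := Real.log p.1 - Real.log p.2

theorem mem_gcdPairs {H g : ℕ} {p : ℕ × ℕ} :
    p ∈ gcdPairs H g ↔ (1 ≤ p.1 ∧ p.1 ≤ H) ∧ (1 ≤ p.2 ∧ p.2 ≤ H) ∧ Nat.gcd p.1 p.2 = g := by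
  simp [gcdPairs, and_assoc]

theorem card_gcdPairs_le {H g : ℕ} (hg : 1 ≤ g) : (#(gcdPairs H g) : ℝ) ≤ ((H : ℝ) / g) ^ 2 := by
  have h1 : #(gcdPairs H g) ≤ #(Icc 1 (H / g) ×ˢ Icc 1 (H / g)) := by
    refine card_le_card_of_injOn (fun p => (p.1 / g, p.2 / g)) ?_ ?_
    · intro p hp
      obtain ⟨⟨h1, h2⟩, ⟨h3, h4⟩, h5⟩ := mem_gcdPairs.1 hp
      have d1 : g ∣ p.1 := h5 ▸ Nat.gcd_dvd_left _ _
      have d2 : g ∣ p.2 := h5 ▸ Nat.gcd_dvd_right _ _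
      simp only [coe_product, coe_Icc, Set.mem_prod, Set.mem_Icc]
      exact ⟨⟨Nat.div_pos (Nat.le_of_dvd h1 d1) hg, Nat.div_le_div_right h2⟩,
        Nat.div_pos (Nat.le_of_dvd h3 d2) hg, Nat.div_le_div_right h4⟩
    · intro p hp q hq hpq
      obtain ⟨-, -, h5⟩ := mem_gcdPairs.1 hp
      obtain ⟨-, -, h6⟩ := mem_gcdPairs.1 hq
      simp only [Prod.mk.injEq] at hpq
      have d1 : g ∣ p.1 := h5 ▸ Nat.gcd_dvd_left _ _
      have d2 : g ∣ p.2 := h5 ▸ Nat.gcd_dvd_right _ _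
      have d3 : g ∣ q.1 := h6 ▸ Nat.gcd_dvd_left _ _
      have d4 : g ∣ q.2 := h6 ▸ Nat.gcd_dvd_right _ _
      exact Prod.ext ((Nat.div_left_inj d1 d3).1 hpq.1) ((Nat.div_left_inj d2 d4).1 hpq.2)
  rw [card_product, Nat.card_Icc, Nat.add_sub_cancel] at h1
  have h2 : ((H / g : ℕ) : ℝ) ≤ (H : ℝ) / g := Nat.cast_div_le
  calc (#(gcdPairs H g) : ℝ) ≤ ((H / g : ℕ) : ℝ) * ((H / g : ℕ) : ℝ) := by exact_mod_cast h1
    _ ≤ _ := by rw [sq]; gcongr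

theorem logRatio_spaced {H g : ℕ} (hg : 1 ≤ g) {p q : ℕ × ℕ} (hp : p ∈ gcdPairs H g)
    (hq : q ∈ gcdPairs H g) (hne : p ≠ q) :
    ((g : ℝ) / H) ^ 2 ≤ |logRatio p - logRatio q| := by
  have key : ∀ P Q : ℕ, 1 ≤ Q → P ≤ H * H → g * g ∣ P → g * g ∣ Q → Q < P →
      ((g : ℝ) / H) ^ 2 ≤ Real.log P - Real.log Q := by
    intro P Q hQ hPH hP' hQ' hlt
    have hQ0 : (0 : ℝ) < Q := by exact_mod_cast hQ
    have hP0 : (0 : ℝ) < P := by exact_mod_cast (by omega : 0 < P)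
    have hH0 : (0 : ℝ) < (H : ℝ) * H := lt_of_lt_of_le hP0 (by exact_mod_cast hPH)
    have hdiff : (g : ℝ) * g ≤ P - Q := by
      have h1 : g * g ≤ P - Q := Nat.le_of_dvd (by omega) (Nat.dvd_sub hP' hQ')
      rw [← Nat.cast_sub hlt.le]
      exact_mod_cast h1
    rw [← Real.log_div hP0.ne' hQ0.ne']
    refine le_trans ?_ (Real.one_sub_inv_le_log_of_pos (div_pos hP0 hQ0))
    rw [inv_div]
    have e1 : 1 - (Q : ℝ) / P = (P - Q) / P := by field_simp
    rw [e1, div_pow, sq, sq]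
    exact div_le_div₀ (by nlinarith [sq_nonneg (g : ℝ)]) hdiff hP0 (by exact_mod_cast hPH)
  obtain ⟨⟨h1, h2⟩, ⟨h3, h4⟩, h5⟩ := mem_gcdPairs.1 hp
  obtain ⟨⟨k1, k2⟩, ⟨k3, k4⟩, k5⟩ := mem_gcdPairs.1 hq
  obtain ⟨a, b⟩ := p
  obtain ⟨a', b'⟩ := q
  simp only at *
  have hneq : a * b' ≠ a' * b := by
    intro heq
    apply hne
    have ha : a = a' := by
      have : a * g = a' * g := by
        calc a * g = Nat.gcd (a * a') (a * b') := by rw [Nat.gcd_mul_left, k5]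
          _ = Nat.gcd (a' * a) (a' * b) := by rw [heq, mul_comm a a']
          _ = a' * g := by rw [Nat.gcd_mul_left, h5]
      exact Nat.eq_of_mul_eq_mul_right hg this
    subst ha
    rw [Nat.eq_of_mul_eq_mul_left h1 heq]
  have da : g ∣ a := h5 ▸ Nat.gcd_dvd_left _ _
  have db : g ∣ b := h5 ▸ Nat.gcd_dvd_right _ _
  have da' : g ∣ a' := k5 ▸ Nat.gcd_dvd_left _ _
  have db' : g ∣ b' := k5 ▸ Nat.gcd_dvd_right _ _
  have hcast : ∀ x : ℕ, 1 ≤ x → (x : ℝ) ≠ 0 := fun x hx => by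
    exact_mod_cast (by omega : x ≠ 0)
  have e1 : logRatio (a, b) - logRatio (a', b') =
      Real.log ((a * b' : ℕ) : ℝ) - Real.log ((a' * b : ℕ) : ℝ) := by
    push_cast
    rw [Real.log_mul (hcast a h1) (hcast b' k3), Real.log_mul (hcast a' k1) (hcast b h3)]
    simp only [logRatio]
    ring
  rw [e1]
  rcases lt_or_gt_of_ne hneq with hlt | hlt
  · rw [abs_sub_comm]
    exact (key _ _ (Nat.mul_pos h1 k3) (Nat.mul_le_mul k2 h4) (mul_dvd_mul da' db)
      (mul_dvd_mul da db') hlt).trans (le_abs_self _)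
  · exact (key _ _ (Nat.mul_pos k1 h3) (Nat.mul_le_mul h2 k4) (mul_dvd_mul da db')
      (mul_dvd_mul da' db) hlt).trans (le_abs_self _)

theorem card_gcdPairs_near_le {H g : ℕ} (hg : 1 ≤ g) (hH : 1 ≤ H) {Δ : ℝ} (hΔ : 0 ≤ Δ) (x : ℝ) :
    (#{p ∈ gcdPairs H g | |logRatio p - x| ≤ Δ} : ℝ) ≤ 2 * Δ * ((H : ℝ) / g) ^ 2 + 1 := by
  have hg0 : (0 : ℝ) < g := by exact_mod_cast hg
  have hH0 : (0 : ℝ) < H := by exact_mod_cast hH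
  have h := card_le_of_spaced {p ∈ gcdPairs H g | |logRatio p - x| ≤ Δ} logRatio
    (σ := ((g : ℝ) / H) ^ 2) (L := 2 * Δ) (t := x - Δ) (by positivity) (by positivity)
    (fun p hp q hq hne => logRatio_spaced hg (mem_filter.1 hp).1 (mem_filter.1 hq).1 hne)
    (fun p hp => by
      have := abs_le.1 (mem_filter.1 hp).2
      constructor <;> linarith [this.1, this.2])
  have e1 : 2 * Δ / ((g : ℝ) / H) ^ 2 = 2 * Δ * ((H : ℝ) / g) ^ 2 := by field_simp
  rwa [e1] at h

theorem card_gcdPairs_product_near_le {γ : ℝ} (hγ : 0 < γ) {H N g d : ℕ} (hg : 1 ≤ g)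
    (hd : 1 ≤ d) (hH : 1 ≤ H) (hN : 1 ≤ N) {Δ : ℝ} (hΔ : 0 ≤ Δ) :
    (#{x ∈ gcdPairs H g ×ˢ gcdPairs N d | |logRatio x.1 + γ * logRatio x.2| ≤ Δ} : ℝ) ≤
      ((H : ℝ) / g) * (N / d) + 2 * (1 + 1 / γ) * Δ * (((H : ℝ) / g) ^ 2 * (N / d) ^ 2) := by
  set u : ℝ := (H : ℝ) / g
  set v : ℝ := (N : ℝ) / d
  have hu : 0 ≤ u := by positivity
  have hv : 0 ≤ v := by positivity
  have b1 : (#{x ∈ gcdPairs H g ×ˢ gcdPairs N d | |logRatio x.1 + γ * logRatio x.2| ≤ Δ} : ℝ) ≤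
      v ^ 2 * (2 * Δ * u ^ 2 + 1) := by
    refine (card_filter_product_le_right (B := 2 * Δ * u ^ 2 + 1) _ _
      (fun p q => |logRatio p + γ * logRatio q| ≤ Δ) fun q _ => ?_).trans
      (mul_le_mul_of_nonneg_right (card_gcdPairs_le hd) (by positivity))
    have := card_gcdPairs_near_le hg hH hΔ (-(γ * logRatio q))
    simpa only [sub_neg_eq_add] using this
  have b2 : (#{x ∈ gcdPairs H g ×ˢ gcdPairs N d | |logRatio x.1 + γ * logRatio x.2| ≤ Δ} : ℝ) ≤
      u ^ 2 * (2 * (Δ / γ) * v ^ 2 + 1) := by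
    refine (card_filter_product_le_left (B := 2 * (Δ / γ) * v ^ 2 + 1) _ _
      (fun p q => |logRatio p + γ * logRatio q| ≤ Δ) fun p _ => ?_).trans
      (mul_le_mul_of_nonneg_right (card_gcdPairs_le hg) (by positivity))
    have := card_gcdPairs_near_le hd hN (div_nonneg hΔ hγ.le) (-(logRatio p / γ))
    have hiff : ∀ q, |logRatio q - -(logRatio p / γ)| ≤ Δ / γ ↔
        |logRatio p + γ * logRatio q| ≤ Δ := by
      intro q
      have e0 : logRatio p + γ * logRatio q = γ * (logRatio q - -(logRatio p / γ)) := by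
        field_simp
        ring
      rw [e0, abs_mul, abs_of_pos hγ, le_div_iff₀' hγ]
    simpa only [hiff] using this
  have hw : 0 ≤ Δ * (u ^ 2 * v ^ 2) := by positivity
  have hw' : 0 ≤ 1 / γ * (Δ * (u ^ 2 * v ^ 2)) := by positivity
  have e1 : 2 * (1 + 1 / γ) * Δ * (u ^ 2 * v ^ 2) =
      2 * (Δ * (u ^ 2 * v ^ 2)) + 2 * (1 / γ * (Δ * (u ^ 2 * v ^ 2))) := by ring
  have e2 : u ^ 2 * (2 * (Δ / γ) * v ^ 2 + 1) = u ^ 2 + 2 * (1 / γ * (Δ * (u ^ 2 * v ^ 2))) := by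
    ring
  rw [e1]
  rw [e2] at b2
  rcases le_total u v with h | h
  · nlinarith [mul_le_mul_of_nonneg_left h hu]
  · nlinarith [mul_le_mul_of_nonneg_left h hv]

theorem sum_Icc_one_div_le (n : ℕ) : ∑ i ∈ Icc 1 n, (1 : ℝ) / i ≤ 1 + Real.log n := by
  have h := harmonic_le_one_add_log n
  rw [harmonic_eq_sum_Icc] at h
  push_cast at h
  simpa only [one_div] using h

/-- The number of quadruples with `h₁ n₁ ^ γ` close to `h₂ n₂ ^ γ` on a logarithmic scale. -/
theorem card_log_close_le {γ : ℝ} (hγ : 0 < γ) {H N : ℕ} (hH : 1 ≤ H) (hN : 1 ≤ N) {Δ : ℝ}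
    (hΔ : 0 ≤ Δ) :
    (#{x ∈ (Icc 1 H ×ˢ Icc 1 H) ×ˢ (Icc 1 N ×ˢ Icc 1 N) |
        |logRatio x.1 + γ * logRatio x.2| ≤ Δ} : ℝ) ≤
      2 * (1 + 1 / γ) * (H * N + Δ * (H * N) ^ 2) * ((1 + Real.log H) * (1 + Real.log N)) := by
  set S := {x ∈ (Icc 1 H ×ˢ Icc 1 H) ×ˢ (Icc 1 N ×ˢ Icc 1 N) |
        |logRatio x.1 + γ * logRatio x.2| ≤ Δ} with hS
  have hmaps : ∀ x ∈ S, (Nat.gcd x.1.1 x.1.2, Nat.gcd x.2.1 x.2.2) ∈ Icc 1 H ×ˢ Icc 1 N := by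
    intro x hx
    simp only [hS, mem_filter, mem_product, mem_Icc] at hx ⊢
    obtain ⟨⟨⟨⟨a1, a2⟩, a3, a4⟩, ⟨b1, b2⟩, b3, b4⟩, -⟩ := hx
    exact ⟨⟨Nat.gcd_pos_of_pos_left _ a1, (Nat.gcd_le_left _ a1).trans a2⟩,
      Nat.gcd_pos_of_pos_left _ b1, (Nat.gcd_le_left _ b1).trans b2⟩
  have hc : 0 < 1 / γ := by positivity
  set W : ℝ := 2 * (1 + 1 / γ) * (H * N + Δ * (H * N) ^ 2) with hW
  have hW0 : 0 ≤ W := by positivity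
  have hfib : ∀ y ∈ Icc 1 H ×ˢ Icc 1 N,
      (#{x ∈ S | (Nat.gcd x.1.1 x.1.2, Nat.gcd x.2.1 x.2.2) = y} : ℝ) ≤
        W * (1 / y.1 * (1 / y.2)) := by
    rintro ⟨g, d⟩ hy
    simp only [mem_product, mem_Icc] at hy
    have hg0 : (1 : ℝ) ≤ g := by exact_mod_cast hy.1.1
    have hd0 : (1 : ℝ) ≤ d := by exact_mod_cast hy.2.1
    have hsub : {x ∈ S | (Nat.gcd x.1.1 x.1.2, Nat.gcd x.2.1 x.2.2) = (g, d)} ⊆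
        {x ∈ gcdPairs H g ×ˢ gcdPairs N d | |logRatio x.1 + γ * logRatio x.2| ≤ Δ} := by
      intro x hx
      simp only [hS, mem_filter, mem_product, mem_Icc, Prod.mk.injEq, mem_gcdPairs] at hx ⊢
      tauto
    refine (Nat.cast_le.2 (card_le_card hsub)).trans
      ((card_gcdPairs_product_near_le hγ hy.1.1 hy.2.1 hH hN hΔ).trans ?_)
    have e1 : (H : ℝ) / g * (N / d) = H * N * (1 / g * (1 / d)) := by field_simp
    have e2 : ((H : ℝ) / g) ^ 2 * (N / d) ^ 2 = (H * N) ^ 2 * (1 / g * (1 / d)) ^ 2 := by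
      field_simp
    have hz1 : 1 / (g : ℝ) * (1 / d) ≤ 1 :=
      mul_le_one₀ (by rw [div_le_one (by linarith)]; exact hg0) (by positivity)
        (by rw [div_le_one (by linarith)]; exact hd0)
    rw [e1, e2]
    simp only
    have hz0 : 0 ≤ 1 / (g : ℝ) * (1 / d) := by positivity
    set z := 1 / (g : ℝ) * (1 / d)
    have hz2 : z ^ 2 ≤ z := by nlinarith
    have h1 : 2 * (1 + 1 / γ) * Δ * ((H * N) ^ 2 * z ^ 2) ≤
        2 * (1 + 1 / γ) * Δ * ((H * N) ^ 2 * z) := by gcongr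
    have h2 : 0 ≤ (H : ℝ) * N * z := by positivity
    rw [hW]
    nlinarith [mul_nonneg hc.le h2]
  rw [card_eq_sum_card_fiberwise hmaps]
  push_cast
  refine (sum_le_sum hfib).trans ?_
  rw [← mul_sum, sum_product]
  simp only
  rw [← sum_mul_sum]
  have hl : ∀ n : ℕ, 0 ≤ ∑ i ∈ Icc 1 n, (1 : ℝ) / i := fun n =>
    sum_nonneg fun i _ => by positivity
  exact mul_le_mul_of_nonneg_left (mul_le_mul (sum_Icc_one_div_le H) (sum_Icc_one_div_le N)
    (hl N) ((hl H).trans (sum_Icc_one_div_le H))) hW0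

/-- Cauchy–Schwarz after grouping the inner variable by the integer part of `K * x j`. -/
theorem norm_sq_bilinear_le {ι : Type*} (s : Finset ℕ) (J : Finset ι)
    (x : ι → ℝ) {K x0 : ℝ} (hK : 1 ≤ K) (hx : ∀ j ∈ J, x0 ≤ x j ∧ x j ≤ x0 + 2) (a : ℕ → ℂ)
    (ha : ∀ m ∈ s, ‖a m‖ ≤ 1) (b : ℕ → ι → ℂ) :
    ‖∑ m ∈ s, a m * ∑ j ∈ J, b m j‖ ^ 2 ≤ #s * (4 * K) *
      ∑ p ∈ J ×ˢ J with |x p.1 - x p.2| ≤ 1 / K,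
        ‖∑ m ∈ s, b m p.1 * (starRingEnd ℂ) (b m p.2)‖ := by
  have hK0 : 0 < K := by linarith
  set fl : ι → ℤ := fun j => ⌊K * x j⌋ with hfl
  set T := J.image fl with hT
  have hmapsT : ∀ j ∈ J, fl j ∈ T := fun j hj => mem_image_of_mem _ hj
  have hTcard : (#T : ℝ) ≤ 4 * K := by
    have h := card_le_of_spaced T (fun k : ℤ => (k : ℝ)) (σ := 1) (L := 2 * K + 1)
      (t := K * x0 - 1) one_pos (by linarith)
      (by
        intro i _ j _ hij
        have : 1 ≤ |i - j| := Int.one_le_abs (sub_ne_zero.2 hij)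
        exact_mod_cast this)
      (by
        intro k hk
        obtain ⟨j, hj, rfl⟩ := mem_image.1 hk
        obtain ⟨h1, h2⟩ := hx j hj
        have h3 := Int.floor_le (K * x j)
        have h4 := Int.lt_floor_add_one (K * x j)
        simp only [hfl]
        constructor <;> nlinarith)
    linarith
  set B : ℕ → ℤ → ℂ := fun m k => ∑ j ∈ J with fl j = k, b m j with hB
  have hsplit : ∀ m, ∑ j ∈ J, b m j = ∑ k ∈ T, B m k := fun m =>
    (sum_fiberwise_of_maps_to hmapsT _).symm
  have h1 : ‖∑ m ∈ s, a m * ∑ j ∈ J, b m j‖ ≤ ∑ y ∈ s ×ˢ T, ‖B y.1 y.2‖ := by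
    rw [sum_product]
    refine (norm_sum_le _ _).trans (sum_le_sum fun m hm => ?_)
    rw [norm_mul, hsplit]
    exact (mul_le_of_le_one_left (norm_nonneg _) (ha m hm)).trans (norm_sum_le _ _)
  have h2 : ‖∑ m ∈ s, a m * ∑ j ∈ J, b m j‖ ^ 2 ≤
      #(s ×ˢ T) * ∑ y ∈ s ×ˢ T, ‖B y.1 y.2‖ ^ 2 :=
    (pow_le_pow_left₀ (norm_nonneg _) h1 2).trans sq_sum_le_card_mul_sum_sq
  have hfib : ∀ k, ∑ m ∈ s, ‖B m k‖ ^ 2 ≤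
      ∑ p ∈ {j ∈ J | fl j = k} ×ˢ {j ∈ J | fl j = k},
        ‖∑ m ∈ s, b m p.1 * (starRingEnd ℂ) (b m p.2)‖ := by
    intro k
    have e1 : ((∑ m ∈ s, ‖B m k‖ ^ 2 : ℝ) : ℂ) =
        ∑ p ∈ {j ∈ J | fl j = k} ×ˢ {j ∈ J | fl j = k},
          ∑ m ∈ s, b m p.1 * (starRingEnd ℂ) (b m p.2) := by
      rw [sum_comm]
      push_cast
      refine sum_congr rfl fun m _ => ?_
      rw [← Complex.mul_conj', hB]
      simp only [map_sum]
      rw [sum_mul_sum, sum_product]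
    have e2 : ∑ m ∈ s, ‖B m k‖ ^ 2 = ‖((∑ m ∈ s, ‖B m k‖ ^ 2 : ℝ) : ℂ)‖ := by
      rw [Complex.norm_real, Real.norm_of_nonneg (sum_nonneg fun _ _ => by positivity)]
    rw [e2, e1]
    exact norm_sum_le _ _
  have h3 : ∑ y ∈ s ×ˢ T, ‖B y.1 y.2‖ ^ 2 ≤
      ∑ p ∈ J ×ˢ J with |x p.1 - x p.2| ≤ 1 / K,
        ‖∑ m ∈ s, b m p.1 * (starRingEnd ℂ) (b m p.2)‖ := by
    rw [sum_product_right]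
    refine (sum_le_sum fun k _ => hfib k).trans ?_
    have hsame : ∑ k ∈ T, ∑ p ∈ {j ∈ J | fl j = k} ×ˢ {j ∈ J | fl j = k},
        ‖∑ m ∈ s, b m p.1 * (starRingEnd ℂ) (b m p.2)‖ =
        ∑ p ∈ J ×ˢ J with fl p.1 = fl p.2,
          ‖∑ m ∈ s, b m p.1 * (starRingEnd ℂ) (b m p.2)‖ := by
      rw [← sum_fiberwise_of_maps_to (t := T) (g := fun p : ι × ι => fl p.1)
        (fun p hp => hmapsT _ (mem_product.1 (mem_filter.1 hp).1).1)]
      refine sum_congr rfl fun k _ => sum_congr ?_ fun _ _ => rfl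
      ext p
      simp only [mem_product, mem_filter]
      constructor
      · rintro ⟨⟨p1, p2⟩, p3, p4⟩
        exact ⟨⟨⟨p1, p3⟩, p2.trans p4.symm⟩, p2⟩
      · rintro ⟨⟨⟨p1, p3⟩, p4⟩, p2⟩
        exact ⟨⟨p1, p2⟩, p3, p4 ▸ p2⟩
    rw [hsame]
    refine sum_le_sum_of_subset_of_nonneg ?_ fun _ _ _ => norm_nonneg _
    intro p hp
    rw [mem_filter] at hp ⊢
    refine ⟨hp.1, ?_⟩
    have h1 := Int.floor_le (K * x p.1)
    have h2 := Int.lt_floor_add_one (K * x p.1)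
    have h3 := Int.floor_le (K * x p.2)
    have h4 := Int.lt_floor_add_one (K * x p.2)
    have h5 : ⌊K * x p.1⌋ = ⌊K * x p.2⌋ := hp.2
    rw [h5] at h1 h2
    have h6 : |K * (x p.1 - x p.2)| ≤ 1 := by rw [abs_le]; constructor <;> linarith
    rw [abs_mul, abs_of_pos hK0] at h6
    rw [le_div_iff₀ hK0]
    linarith
  have h4 : 0 ≤ ∑ p ∈ J ×ˢ J with |x p.1 - x p.2| ≤ 1 / K,
      ‖∑ m ∈ s, b m p.1 * (starRingEnd ℂ) (b m p.2)‖ := sum_nonneg fun _ _ => norm_nonneg _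
  refine h2.trans (mul_le_mul ?_ h3 (sum_nonneg fun _ _ => by positivity) (by positivity))
  rw [card_product]
  push_cast
  exact mul_le_mul_of_nonneg_left hTcard (Nat.cast_nonneg _)

theorem mul_log_sub_le {p q b B : ℝ} (hb : 0 < b) (hp : b ≤ p) (hpB : p ≤ B) (hq : b ≤ q)
    (hqB : q ≤ B) :
    b * |Real.log p - Real.log q| ≤ |p - q| ∧ |p - q| ≤ B * |Real.log p - Real.log q| := by
  wlog h : q ≤ p generalizing p q
  · rw [abs_sub_comm, abs_sub_comm p]
    exact this hq hqB hp hpB (le_of_not_ge h)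
  have hp0 : 0 < p := by linarith
  have hq0 : 0 < q := by linarith
  rw [abs_of_nonneg (sub_nonneg.2 (Real.log_le_log hq0 h)), abs_of_nonneg (sub_nonneg.2 h),
    ← Real.log_div hp0.ne' hq0.ne']
  have hpq : 0 < p / q := div_pos hp0 hq0
  have h1 := Real.log_le_sub_one_of_pos hpq
  have h2 := Real.one_sub_inv_le_log_of_pos hpq
  rw [inv_div] at h2
  have e1 : q * (p / q - 1) = p - q := by field_simp
  have e2 : p * (1 - q / p) = p - q := by field_simp
  have h0 : 0 ≤ Real.log (p / q) := Real.log_nonneg (by rwa [le_div_iff₀ hq0, one_mul])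
  constructor
  · nlinarith
  · nlinarith

theorem mem_dyN {Y : ℝ} {m : ℕ} : m ∈ dyN Y ↔ Y / 2 ≤ (m : ℝ) ∧ (m : ℝ) < Y := by
  simp only [dyN, mem_filter, mem_range, and_iff_right_iff_imp]
  rintro ⟨-, h⟩
  have : m < ⌈Y⌉₊ := Nat.lt_ceil.2 h
  omega

theorem card_dyN_le {Y : ℝ} (hY : 1 ≤ Y) : (#(dyN Y) : ℝ) ≤ Y := by
  have h : dyN Y ⊆ Icc 1 ⌊Y⌋₊ := by
    intro m hm
    obtain ⟨h1, h2⟩ := mem_dyN.1 hm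
    have : (0 : ℝ) < m := by linarith
    exact mem_Icc.2 ⟨by exact_mod_cast this, Nat.le_floor h2.le⟩
  have h1 := card_le_card h
  rw [Nat.card_Icc, Nat.add_sub_cancel] at h1
  exact (Nat.cast_le.2 h1).trans (Nat.floor_le (by linarith))

/-- The logarithm of `h * n ^ γ` for the pair `j = (h, n)`. -/
noncomputable def logSize (γ : ℝ) (j : ℕ × ℕ) : ℝ := Real.log j.1 + γ * Real.log j.2

theorem logSize_eq_log {γ : ℝ} {j : ℕ × ℕ} (h1 : 0 < j.1) (h2 : 0 < j.2) :
    logSize γ j = Real.log (j.1 * (j.2 : ℝ) ^ γ) := by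
  have a1 : (0 : ℝ) < j.1 := by exact_mod_cast h1
  have a2 : (0 : ℝ) < j.2 := by exact_mod_cast h2
  rw [Real.log_mul a1.ne' (Real.rpow_pos_of_pos a2 _).ne', Real.log_rpow a2, logSize]

theorem pos_of_mem_dyN {Y : ℝ} (hY : 1 ≤ Y) {m : ℕ} (hm : m ∈ dyN Y) : 0 < m := by
  have h : (0 : ℝ) < m := by linarith [(mem_dyN.1 hm).1]
  exact_mod_cast h

theorem size_mem_dyN {γ V N : ℝ} (hγ0 : 0 < γ) (hγ1 : γ < 1) (hV : 1 ≤ V) (hN : 1 ≤ N)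
    {j : ℕ × ℕ} (hj : j ∈ dyN V ×ˢ dyN N) :
    V * N ^ γ / 4 ≤ j.1 * (j.2 : ℝ) ^ γ ∧ j.1 * (j.2 : ℝ) ^ γ ≤ V * N ^ γ := by
  obtain ⟨hh, hn⟩ := mem_product.1 hj
  obtain ⟨h1, h2⟩ := mem_dyN.1 hh
  obtain ⟨n1, n2⟩ := mem_dyN.1 hn
  have hN2 : N ^ γ / 2 ≤ (N / 2) ^ γ := by
    rw [Real.div_rpow (by linarith) (by norm_num)]
    gcongr
    calc (2 : ℝ) ^ γ ≤ 2 ^ (1 : ℝ) :=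
          Real.rpow_le_rpow_of_exponent_le (by norm_num) hγ1.le
      _ = 2 := by norm_num
  have hn1 : (N / 2) ^ γ ≤ (j.2 : ℝ) ^ γ := Real.rpow_le_rpow (by linarith) n1 hγ0.le
  have hn2 : (j.2 : ℝ) ^ γ ≤ N ^ γ := Real.rpow_le_rpow (by positivity) n2.le hγ0.le
  have hNg : 0 < N ^ γ := Real.rpow_pos_of_pos (by linarith) _
  constructor
  · calc V * N ^ γ / 4 = V / 2 * (N ^ γ / 2) := by ring
      _ ≤ _ := mul_le_mul h1 (hN2.trans hn1) (by positivity) (by positivity)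
  · exact mul_le_mul h2.le hn2 (by positivity) (by linarith)

theorem card_logSize_close_le {γ V N Δ : ℝ} (hγ : 0 < γ) (hV : 1 ≤ V) (hN : 1 ≤ N)
    (hΔ : 0 ≤ Δ) :
    (#{p ∈ (dyN V ×ˢ dyN N) ×ˢ (dyN V ×ˢ dyN N) | |logSize γ p.1 - logSize γ p.2| ≤ Δ} : ℝ) ≤
      2 * (1 + 1 / γ) * (V * N + Δ * (V * N) ^ 2) * ((1 + Real.log V) * (1 + Real.log N)) := by
  have hVf : 1 ≤ ⌊V⌋₊ := Nat.le_floor (by simpa using hV)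
  have hNf : 1 ≤ ⌊N⌋₊ := Nat.le_floor (by simpa using hN)
  have hVr : (1 : ℝ) ≤ (⌊V⌋₊ : ℝ) := by exact_mod_cast hVf
  have hNr : (1 : ℝ) ≤ (⌊N⌋₊ : ℝ) := by exact_mod_cast hNf
  have hV' : (⌊V⌋₊ : ℝ) ≤ V := Nat.floor_le (by linarith)
  have hN' : (⌊N⌋₊ : ℝ) ≤ N := Nat.floor_le (by linarith)
  have hcard : #{p ∈ (dyN V ×ˢ dyN N) ×ˢ (dyN V ×ˢ dyN N) |
      |logSize γ p.1 - logSize γ p.2| ≤ Δ} ≤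
      #{x ∈ (Icc 1 ⌊V⌋₊ ×ˢ Icc 1 ⌊V⌋₊) ×ˢ (Icc 1 ⌊N⌋₊ ×ˢ Icc 1 ⌊N⌋₊) |
        |logRatio x.1 + γ * logRatio x.2| ≤ Δ} := by
    refine card_le_card_of_injOn (fun p => ((p.1.1, p.2.1), (p.1.2, p.2.2))) ?_ ?_
    · intro p hp
      have hp := mem_filter.1 hp
      simp only [mem_product] at hp
      obtain ⟨⟨⟨a1, a2⟩, a3, a4⟩, a5⟩ := hp
      have hmem : ∀ {Y : ℝ} {m : ℕ}, 1 ≤ Y → m ∈ dyN Y → m ∈ Icc 1 ⌊Y⌋₊ := fun hY hm =>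
        mem_Icc.2 ⟨pos_of_mem_dyN hY hm, Nat.le_floor (mem_dyN.1 hm).2.le⟩
      refine mem_filter.2 ⟨mem_product.2 ⟨mem_product.2 ⟨hmem hV a1, hmem hV a3⟩,
        mem_product.2 ⟨hmem hN a2, hmem hN a4⟩⟩, ?_⟩
      have e1 : logRatio (p.1.1, p.2.1) + γ * logRatio (p.1.2, p.2.2) =
          logSize γ p.1 - logSize γ p.2 := by
        simp only [logRatio, logSize]; ring
      simpa only [e1] using a5
    · intro p _ q _ hpq
      simp only [Prod.mk.injEq] at hpq
      exact Prod.ext (Prod.ext hpq.1.1 hpq.2.1) (Prod.ext hpq.1.2 hpq.2.2)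
  refine (Nat.cast_le.2 hcard).trans ((card_log_close_le hγ hVf hNf hΔ).trans ?_)
  have l1 := Real.log_nonneg hVr
  have l2 := Real.log_nonneg hNr
  have l3 := Real.log_le_log (by linarith) hV'
  have l4 := Real.log_le_log (by linarith) hN'
  gcongr
  linarith

theorem norm_kernel_le {γ M N V K : ℝ} (hγ0 : 0 < γ) (hγ1 : γ < 1) (hM : 1 ≤ M) (hN : 1 ≤ N)
    (hV : 1 ≤ V) (hK : 1 ≤ K) {j j' : ℕ × ℕ} (hj : j ∈ dyN V ×ˢ dyN N)
    (hj' : j' ∈ dyN V ×ˢ dyN N) (hfar : 1 / (V * N) ≤ |logSize γ j - logSize γ j'|)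
    (hnear : |logSize γ j - logSize γ j'| ≤ 1 / K) (s : Finset ℕ) (hs : s ⊆ dyN M)
    (hc : ∀ a ∈ s, ∀ b ∈ s, ∀ x, a ≤ x → x ≤ b → x ∈ s) :
    ‖∑ m ∈ s, e ((j.1 * (j.2 : ℝ) ^ γ - j'.1 * (j'.2 : ℝ) ^ γ) * (m : ℝ) ^ γ)‖ ≤
      504 * (1 + 3 / Real.sqrt (γ * (1 - γ))) *
        (Real.sqrt (V * (M * N) ^ γ / K) + 2 * M * Real.sqrt (N / (M * N) ^ γ)) := by
  have hM0 : 0 < M := by linarith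
  have hN0 : 0 < N := by linarith
  have hV0 : 0 < V := by linarith
  have hK0 : 0 < K := by linarith
  have hNg : 0 < N ^ γ := Real.rpow_pos_of_pos hN0 _
  have hpos : ∀ i ∈ dyN V ×ˢ dyN N, 0 < i.1 ∧ 0 < i.2 := fun i hi =>
    ⟨pos_of_mem_dyN hV (mem_product.1 hi).1, pos_of_mem_dyN hN (mem_product.1 hi).2⟩
  obtain ⟨s1, s2⟩ := size_mem_dyN hγ0 hγ1 hV hN hj
  obtain ⟨s3, s4⟩ := size_mem_dyN hγ0 hγ1 hV hN hj'
  set A := (j.1 : ℝ) * (j.2 : ℝ) ^ γ - j'.1 * (j'.2 : ℝ) ^ γ with hA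
  obtain ⟨hAl, hAu⟩ := mul_log_sub_le (by positivity : 0 < V * N ^ γ / 4) s1 s2 s3 s4
  rw [← logSize_eq_log (hpos j hj).1 (hpos j hj).2, ← logSize_eq_log (hpos j' hj').1 (hpos j' hj').2,
    ← hA] at hAl hAu
  set t := |logSize γ j - logSize γ j'| with ht
  have hAl' : N ^ γ / (4 * N) ≤ |A| := by
    refine le_trans ?_ hAl
    calc N ^ γ / (4 * N) = V * N ^ γ / 4 * (1 / (V * N)) := by field_simp
      _ ≤ _ := mul_le_mul_of_nonneg_left hfar (by positivity)
  have hAu' : |A| ≤ V * N ^ γ / K := by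
    refine hAu.trans ?_
    calc V * N ^ γ * t ≤ V * N ^ γ * (1 / K) := mul_le_mul_of_nonneg_left hnear (by positivity)
      _ = _ := by ring
  have hA0 : 0 < |A| := lt_of_lt_of_le (by positivity) hAl'
  have habs : ‖∑ m ∈ s, e (A * (m : ℝ) ^ γ)‖ = ‖∑ m ∈ s, e (|A| * (m : ℝ) ^ γ)‖ := by
    rcases abs_choice A with h | h
    · rw [h]
    · rw [← RCLike.norm_conj, map_sum, h]
      simp only [conj_e, neg_mul]
  rw [habs]
  refine (norm_sum_e_rpow_le hγ0 hγ1 hA0 hM s (fun m hm => mem_dyN.1 (hs hm)) hc).trans ?_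
  have hg : 0 < Real.sqrt (γ * (1 - γ)) := Real.sqrt_pos.2 (mul_pos hγ0 (by linarith))
  refine mul_le_mul_of_nonneg_left ?_ (by positivity)
  have hcard : (#s : ℝ) ≤ M := (Nat.cast_le.2 (card_le_card hs)).trans (card_dyN_le hM)
  have hMg : 0 < M ^ γ := Real.rpow_pos_of_pos hM0 _
  have hP : M ^ (γ - 2) = M ^ γ / M ^ 2 := by
    rw [Real.rpow_sub hM0]; norm_num
  have hMN : (M * N) ^ γ = M ^ γ * N ^ γ := Real.mul_rpow hM0.le hN0.le
  rw [hP, hMN]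
  refine add_le_add ?_ ?_
  · calc (#s : ℝ) * Real.sqrt (|A| * (M ^ γ / M ^ 2))
        ≤ M * Real.sqrt (V * N ^ γ / K * (M ^ γ / M ^ 2)) := by gcongr
      _ = Real.sqrt (M ^ 2 * (V * N ^ γ / K * (M ^ γ / M ^ 2))) := by
          rw [Real.sqrt_mul (sq_nonneg M), Real.sqrt_sq hM0.le]
      _ = _ := by congr 1; field_simp
  · have hle : N ^ γ / (4 * N) * (M ^ γ / M ^ 2) ≤ |A| * (M ^ γ / M ^ 2) := by gcongr
    calc 1 / Real.sqrt (|A| * (M ^ γ / M ^ 2))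
        ≤ 1 / Real.sqrt (N ^ γ / (4 * N) * (M ^ γ / M ^ 2)) := by
          apply one_div_le_one_div_of_le (Real.sqrt_pos.2 (by positivity))
          exact Real.sqrt_le_sqrt hle
      _ = Real.sqrt ((2 * M) ^ 2 * (N / (M ^ γ * N ^ γ))) := by
          rw [one_div, ← Real.sqrt_inv]
          congr 1
          field_simp
          norm_num
      _ = _ := by rw [Real.sqrt_mul (sq_nonneg _), Real.sqrt_sq (by positivity)]

/-- The weight attached to the pair `j = (h, n)` and the integer `m`. -/
noncomputable def bilinearTerm (γ X : ℝ) (d : ℕ → ℂ) (m : ℕ) (j : ℕ × ℕ) : ℂ :=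
  if X / 2 ≤ ((m * j.2 : ℕ) : ℝ) ∧ ((m * j.2 : ℕ) : ℝ) < X then
    d j.1 * e ((j.1 : ℝ) * ((m : ℝ) * j.2) ^ γ) else 0

theorem norm_sum_bilinearTerm_mul_conj_le (γ X : ℝ) (d : ℕ → ℂ) (s : Finset ℕ) (j j' : ℕ × ℕ)
    (hd : ‖d j.1‖ ≤ 1) (hd' : ‖d j'.1‖ ≤ 1) :
    ‖∑ m ∈ s, bilinearTerm γ X d m j * (starRingEnd ℂ) (bilinearTerm γ X d m j')‖ ≤
      ‖∑ m ∈ s with (X / 2 ≤ ((m * j.2 : ℕ) : ℝ) ∧ ((m * j.2 : ℕ) : ℝ) < X) ∧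
          (X / 2 ≤ ((m * j'.2 : ℕ) : ℝ) ∧ ((m * j'.2 : ℕ) : ℝ) < X),
        e ((j.1 * (j.2 : ℝ) ^ γ - j'.1 * (j'.2 : ℝ) ^ γ) * (m : ℝ) ^ γ)‖ := by
  have h : ∑ m ∈ s, bilinearTerm γ X d m j * (starRingEnd ℂ) (bilinearTerm γ X d m j') =
      d j.1 * (starRingEnd ℂ) (d j'.1) *
      ∑ m ∈ s with (X / 2 ≤ ((m * j.2 : ℕ) : ℝ) ∧ ((m * j.2 : ℕ) : ℝ) < X) ∧
          (X / 2 ≤ ((m * j'.2 : ℕ) : ℝ) ∧ ((m * j'.2 : ℕ) : ℝ) < X),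
        e ((j.1 * (j.2 : ℝ) ^ γ - j'.1 * (j'.2 : ℝ) ^ γ) * (m : ℝ) ^ γ) := by
    rw [sum_filter, mul_sum]
    refine sum_congr rfl fun m _ => ?_
    have e1 : e ((j.1 * (j.2 : ℝ) ^ γ - j'.1 * (j'.2 : ℝ) ^ γ) * (m : ℝ) ^ γ) =
        e ((j.1 : ℝ) * ((m : ℝ) * j.2) ^ γ) *
          (starRingEnd ℂ) (e ((j'.1 : ℝ) * ((m : ℝ) * j'.2) ^ γ)) := by
      rw [conj_e, ← e_add, Real.mul_rpow (Nat.cast_nonneg _) (Nat.cast_nonneg _),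
        Real.mul_rpow (Nat.cast_nonneg _) (Nat.cast_nonneg _)]
      congr 1
      ring
    rw [e1]
    simp only [bilinearTerm]
    split_ifs with h1 h2 h3 h3 <;> first | tauto | skip
    · rw [map_mul]; ring
    all_goals simp
  rw [h, norm_mul, norm_mul, RCLike.norm_conj]
  exact mul_le_of_le_one_left (norm_nonneg _) (mul_le_one₀ hd (norm_nonneg _) hd')

theorem ordConnected_dyN_filter (M X : ℝ) (n n' : ℕ) (a : ℕ)
    (ha : a ∈ {m ∈ dyN M | (X / 2 ≤ ((m * n : ℕ) : ℝ) ∧ ((m * n : ℕ) : ℝ) < X) ∧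
      (X / 2 ≤ ((m * n' : ℕ) : ℝ) ∧ ((m * n' : ℕ) : ℝ) < X)}) (b : ℕ)
    (hb : b ∈ {m ∈ dyN M | (X / 2 ≤ ((m * n : ℕ) : ℝ) ∧ ((m * n : ℕ) : ℝ) < X) ∧
      (X / 2 ≤ ((m * n' : ℕ) : ℝ) ∧ ((m * n' : ℕ) : ℝ) < X)}) (x : ℕ) (hax : a ≤ x)
    (hxb : x ≤ b) :
    x ∈ {m ∈ dyN M | (X / 2 ≤ ((m * n : ℕ) : ℝ) ∧ ((m * n : ℕ) : ℝ) < X) ∧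
      (X / 2 ≤ ((m * n' : ℕ) : ℝ) ∧ ((m * n' : ℕ) : ℝ) < X)} := by
  simp only [mem_filter, mem_dyN] at *
  have h1 : (a : ℝ) ≤ x := by exact_mod_cast hax
  have h2 : (x : ℝ) ≤ b := by exact_mod_cast hxb
  have h3 : ∀ k : ℕ, ((a * k : ℕ) : ℝ) ≤ ((x * k : ℕ) : ℝ) := fun k => by
    exact_mod_cast Nat.mul_le_mul_right k hax
  have h4 : ∀ k : ℕ, ((x * k : ℕ) : ℝ) ≤ ((b * k : ℕ) : ℝ) := fun k => by
    exact_mod_cast Nat.mul_le_mul_right k hxb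
  refine ⟨⟨ha.1.1.trans h1, h2.trans_lt hb.1.2⟩, ⟨ha.2.1.1.trans (h3 n),
    (h4 n).trans_lt hb.2.1.2⟩, ha.2.2.1.trans (h3 n'), (h4 n').trans_lt hb.2.2.2⟩

/-- The bilinear estimate with a free grouping parameter `K`, for positive frequencies. -/
theorem norm_sq_bilinear_dyN_le {γ X M N V K : ℝ} (hγ0 : 0 < γ) (hγ1 : γ < 1) (hM : 1 ≤ M)
    (hN : 1 ≤ N) (hV : 1 ≤ V) (hK : 1 ≤ K) (a d : ℕ → ℂ) (ha : ∀ m ∈ dyN M, ‖a m‖ ≤ 1)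
    (hd : ∀ h ∈ dyN V, ‖d h‖ ≤ 1) :
    ‖∑ m ∈ dyN M, ∑ n ∈ (dyN N).filter
        (fun n => X / 2 ≤ ((m * n : ℕ) : ℝ) ∧ ((m * n : ℕ) : ℝ) < X),
        ∑ h ∈ dyN V, a m * d h * e ((h : ℝ) * ((m : ℝ) * (n : ℝ)) ^ γ)‖ ^ 2 ≤
      M * (4 * K) * (2 * (1 + 1 / γ) * ((1 + Real.log V) * (1 + Real.log N)) *
        (2 * (V * N) * M + (V * N + (V * N) ^ 2 / K) *
          (504 * (1 + 3 / Real.sqrt (γ * (1 - γ))) *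
            (Real.sqrt (V * (M * N) ^ γ / K) + 2 * M * Real.sqrt (N / (M * N) ^ γ))))) := by
  have hM0 : 0 < M := by linarith
  have hN0 : 0 < N := by linarith
  have hV0 : 0 < V := by linarith
  have hK0 : 0 < K := by linarith
  have hVN : 0 < V * N := by positivity
  set J := dyN V ×ˢ dyN N with hJ
  have hsum : ∑ m ∈ dyN M, ∑ n ∈ (dyN N).filter
        (fun n => X / 2 ≤ ((m * n : ℕ) : ℝ) ∧ ((m * n : ℕ) : ℝ) < X),
        ∑ h ∈ dyN V, a m * d h * e ((h : ℝ) * ((m : ℝ) * (n : ℝ)) ^ γ) =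
      ∑ m ∈ dyN M, a m * ∑ j ∈ J, bilinearTerm γ X d m j := by
    refine sum_congr rfl fun m _ => ?_
    rw [hJ, sum_product_right, sum_filter, mul_sum]
    refine sum_congr rfl fun n _ => ?_
    rw [mul_sum]
    simp only [bilinearTerm]
    split_ifs
    · exact sum_congr rfl fun h _ => by ring
    · simp
  rw [hsum]
  have hx : ∀ j ∈ J, Real.log (V * N ^ γ / 4) ≤ logSize γ j ∧
      logSize γ j ≤ Real.log (V * N ^ γ / 4) + 2 := by
    intro j hj
    have hNg : 0 < N ^ γ := Real.rpow_pos_of_pos hN0 _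
    obtain ⟨s1, s2⟩ := size_mem_dyN hγ0 hγ1 hV hN hj
    rw [logSize_eq_log (pos_of_mem_dyN hV (mem_product.1 hj).1)
      (pos_of_mem_dyN hN (mem_product.1 hj).2)]
    have hpos : 0 < V * N ^ γ / 4 := by positivity
    refine ⟨Real.log_le_log hpos s1, (Real.log_le_log (hpos.trans_le s1) s2).trans ?_⟩
    rw [Real.log_div (by positivity) (by norm_num)]
    have : Real.log 4 ≤ 2 := by
      rw [show (4 : ℝ) = 2 ^ 2 by norm_num, Real.log_pow]
      have := Real.log_two_lt_d9
      push_cast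
      linarith
    linarith
  refine (norm_sq_bilinear_le (dyN M) J (logSize γ) hK hx a ha (bilinearTerm γ X d)).trans ?_
  set Lg := (1 + Real.log V) * (1 + Real.log N) with hLg
  set c1 := 2 * (1 + 1 / γ) with hc1
  set D := 504 * (1 + 3 / Real.sqrt (γ * (1 - γ))) *
    (Real.sqrt (V * (M * N) ^ γ / K) + 2 * M * Real.sqrt (N / (M * N) ^ γ)) with hD
  have hg : 0 < Real.sqrt (γ * (1 - γ)) := Real.sqrt_pos.2 (mul_pos hγ0 (by linarith))
  have hD0 : 0 ≤ D := by positivity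
  have hterm : ∀ p ∈ {p ∈ J ×ˢ J | |logSize γ p.1 - logSize γ p.2| ≤ 1 / K},
      ‖∑ m ∈ dyN M, bilinearTerm γ X d m p.1 * (starRingEnd ℂ) (bilinearTerm γ X d m p.2)‖ ≤
      (if |logSize γ p.1 - logSize γ p.2| ≤ 1 / (V * N) then M else 0) + D := by
    intro p hp
    obtain ⟨hpJ, hnear⟩ := mem_filter.1 hp
    obtain ⟨hp1, hp2⟩ := mem_product.1 hpJ
    refine (norm_sum_bilinearTerm_mul_conj_le γ X d (dyN M) p.1 p.2
      (hd _ (mem_product.1 hp1).1) (hd _ (mem_product.1 hp2).1)).trans ?_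
    split_ifs with hclose
    · have : ∀ s ⊆ dyN M, ∀ f : ℕ → ℝ, ‖∑ m ∈ s, e (f m)‖ ≤ M := by
        intro s hs f
        refine (norm_sum_le _ _).trans ?_
        simp only [norm_e, sum_const, nsmul_eq_mul, mul_one]
        exact (Nat.cast_le.2 (card_le_card hs)).trans (card_dyN_le hM)
      have := this _ (filter_subset (fun m : ℕ => (X / 2 ≤ ((m * p.1.2 : ℕ) : ℝ) ∧
          ((m * p.1.2 : ℕ) : ℝ) < X) ∧ (X / 2 ≤ ((m * p.2.2 : ℕ) : ℝ) ∧
          ((m * p.2.2 : ℕ) : ℝ) < X)) (dyN M))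
        (fun m => (p.1.1 * (p.1.2 : ℝ) ^ γ - p.2.1 * (p.2.2 : ℝ) ^ γ) * (m : ℝ) ^ γ)
      linarith
    · rw [zero_add]
      exact norm_kernel_le hγ0 hγ1 hM hN hV hK hp1 hp2 (le_of_not_ge hclose) hnear _
        (filter_subset _ _) (ordConnected_dyN_filter M X p.1.2 p.2.2)
  have hclose := card_logSize_close_le (Δ := 1 / (V * N)) hγ0 hV hN (by positivity)
  have hall := card_logSize_close_le (Δ := 1 / K) hγ0 hV hN (by positivity)
  have e1 : 1 / (V * N) * (V * N) ^ 2 = V * N := by field_simp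
  rw [e1, ← hLg, ← hc1, ← hJ] at hclose
  rw [← hLg, ← hc1, ← hJ] at hall
  have hfin : ∑ p ∈ J ×ˢ J with |logSize γ p.1 - logSize γ p.2| ≤ 1 / K,
      ‖∑ m ∈ dyN M, bilinearTerm γ X d m p.1 * (starRingEnd ℂ) (bilinearTerm γ X d m p.2)‖ ≤
      c1 * Lg * (2 * (V * N) * M + (V * N + (V * N) ^ 2 / K) * D) := by
    refine (sum_le_sum hterm).trans ?_
    rw [sum_add_distrib, ← sum_filter, sum_const, sum_const, nsmul_eq_mul, nsmul_eq_mul]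
    have h1 : (#{p ∈ {p ∈ J ×ˢ J | |logSize γ p.1 - logSize γ p.2| ≤ 1 / K} |
        |logSize γ p.1 - logSize γ p.2| ≤ 1 / (V * N)} : ℝ) ≤ c1 * (V * N + V * N) * Lg := by
      refine le_trans (Nat.cast_le.2 (card_le_card ?_)) hclose
      exact filter_subset_filter _ (filter_subset _ _)
    have h2 := mul_le_mul_of_nonneg_right h1 hM0.le
    have h3 := mul_le_mul_of_nonneg_right hall hD0
    refine (add_le_add h2 h3).trans (le_of_eq ?_)
    ring
  have hcd := card_dyN_le hM
  have hS0 : 0 ≤ ∑ p ∈ J ×ˢ J with |logSize γ p.1 - logSize γ p.2| ≤ 1 / K,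
      ‖∑ m ∈ dyN M, bilinearTerm γ X d m p.1 * (starRingEnd ℂ) (bilinearTerm γ X d m p.2)‖ :=
    sum_nonneg fun _ _ => norm_nonneg _
  exact mul_le_mul (mul_le_mul_of_nonneg_right hcd (by positivity)) hfin hS0 (by positivity)

theorem log_product_le {ε v P N V : ℝ} (hε : 0 < ε) (hv : 0 ≤ v) (hP : 1 ≤ P) (hN1 : 1 ≤ N)
    (hV1 : 1 ≤ V) (hN : N ≤ 4 * P) (hV : V ≤ 20 * P ^ v) :
    (1 + Real.log V) * (1 + Real.log N) ≤ 3 * (5 + v) * (1 + 2 / ε) ^ 2 * P ^ ε := by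
  have hP0 : 0 < P := by linarith
  have hlP := Real.log_nonneg hP
  have l4 : Real.log 4 ≤ 2 := by
    rw [show (4 : ℝ) = 2 ^ 2 by norm_num, Real.log_pow]
    have := Real.log_two_lt_d9
    push_cast
    linarith
  have l20 : Real.log 20 ≤ 4 := by
    have h1 : Real.log 20 ≤ Real.log (2 ^ 5) := Real.log_le_log (by norm_num) (by norm_num)
    rw [Real.log_pow] at h1
    have := Real.log_two_lt_d9
    push_cast at h1
    linarith
  have hp := Real.one_le_rpow hP (half_pos hε).le
  have hlog : 1 + Real.log P ≤ (1 + 2 / ε) * P ^ (ε / 2) := by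
    have h1 := Real.log_le_rpow_div hP0.le (half_pos hε)
    have h2 : P ^ (ε / 2) / (ε / 2) = 2 / ε * P ^ (ε / 2) := by field_simp
    rw [h2] at h1
    linarith
  have hNl : 1 + Real.log N ≤ 3 * (1 + Real.log P) := by
    have h1 := Real.log_le_log (by linarith) hN
    rw [Real.log_mul (by norm_num) hP0.ne'] at h1
    linarith
  have hVl : 1 + Real.log V ≤ (5 + v) * (1 + Real.log P) := by
    have h1 := Real.log_le_log (by linarith) hV
    rw [Real.log_mul (by norm_num) (Real.rpow_pos_of_pos hP0 _).ne', Real.log_rpow hP0] at h1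
    nlinarith
  have hVl0 := Real.log_nonneg hV1
  have hNl0 := Real.log_nonneg hN1
  calc (1 + Real.log V) * (1 + Real.log N)
      ≤ ((5 + v) * (1 + Real.log P)) * (3 * (1 + Real.log P)) :=
        mul_le_mul hVl hNl (by linarith) (by positivity)
    _ = 3 * (5 + v) * (1 + Real.log P) ^ 2 := by ring
    _ ≤ 3 * (5 + v) * ((1 + 2 / ε) * P ^ (ε / 2)) ^ 2 := by gcongr
    _ = 3 * (5 + v) * (1 + 2 / ε) ^ 2 * (P ^ (ε / 2)) ^ 2 := by ring
    _ = _ := by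
        rw [← Real.rpow_mul_natCast hP0.le]
        congr 2
        push_cast
        ring

/-- Numerical optimisation of the grouping parameter. -/
theorem grouped_bound_le {γ ε η P M N V c1 c2 Lg W : ℝ} (hγ0 : 0 < γ) (hγ1 : γ < 1) (hε : 0 < ε)
    (hη : 0 < η) (hP : 1 ≤ P) (hM : 1 ≤ M) (hN : 1 ≤ N) (hV1 : 1 ≤ V)
    (hM1 : P ^ (5 - 5 * γ + 6 * ε + 18 * η) ≤ M)
    (hV : V ≤ 20 * P ^ (1 - γ + η)) (hMN1 : P / 2 ≤ M * N) (hMN2 : M * N ≤ 4 * P)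
    (hc1 : 0 ≤ c1) (hc2 : 0 ≤ c2) (hLg0 : 0 ≤ Lg) (hLg : Lg ≤ W * P ^ ε)
    {K : ℝ} (hK : K = P ^ (γ - ε - 5 * η) / M) :
    M * (4 * K) * (c1 * Lg * (2 * (V * N) * M + (V * N + (V * N) ^ 2 / K) *
      (c2 * (Real.sqrt (V * (M * N) ^ γ / K) + 2 * M * Real.sqrt (N / (M * N) ^ γ))))) ≤
      4 * c1 * W * (160 + 300000 * c2) * P ^ (2 - 4 * η) := by
  have hP0 : 0 < P := by linarith
  have hM0 : 0 < M := by linarith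
  have hN0 : 0 < N := by linarith
  have hV0 : 0 < V := by linarith
  set Q := P ^ (γ - ε - 5 * η) with hQ
  set v := 1 - γ + η with hv
  set y := P ^ (2 - ε - 4 * η) with hy
  have hQ0 : 0 < Q := Real.rpow_pos_of_pos hP0 _
  have hy0 : 0 < y := Real.rpow_pos_of_pos hP0 _
  have hK0 : 0 < K := by rw [hK]; positivity
  have hKM : K * M = Q := by rw [hK]; field_simp
  have hPv : 0 < P ^ v := Real.rpow_pos_of_pos hP0 _
  have hPg : 0 < P ^ γ := Real.rpow_pos_of_pos hP0 _
  have hG1 : (M * N) ^ γ ≤ 4 * P ^ γ := by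
    calc (M * N) ^ γ ≤ (4 * P) ^ γ := Real.rpow_le_rpow (by positivity) hMN2 hγ0.le
      _ = 4 ^ γ * P ^ γ := Real.mul_rpow (by norm_num) hP0.le
      _ ≤ 4 ^ (1 : ℝ) * P ^ γ := by
          gcongr
          norm_num
      _ = _ := by norm_num
  have hG2 : P ^ γ / 2 ≤ (M * N) ^ γ := by
    calc P ^ γ / 2 = P ^ γ / 2 ^ (1 : ℝ) := by norm_num
      _ ≤ P ^ γ / 2 ^ γ := by
          gcongr
          norm_num
      _ = (P / 2) ^ γ := (Real.div_rpow hP0.le (by norm_num) _).symm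
      _ ≤ _ := Real.rpow_le_rpow (by positivity) hMN1 hγ0.le
  have hG0 : 0 < (M * N) ^ γ := Real.rpow_pos_of_pos (by positivity) _
  have hV2 : V ^ 2 ≤ 400 * P ^ (2 * v) := by
    calc V ^ 2 ≤ (20 * P ^ v) ^ 2 := by gcongr
      _ = 400 * (P ^ v) ^ 2 := by ring
      _ = _ := by
          rw [← Real.rpow_mul_natCast hP0.le]
          congr 2
          push_cast
          ring
  have hMNsq : (M * N) ^ 2 ≤ 16 * P ^ (2 : ℝ) := by
    calc (M * N) ^ 2 ≤ (4 * P) ^ 2 := by gcongr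
      _ = 16 * P ^ 2 := by ring
      _ = _ := by norm_num
  have hprod : (M * N) ^ 2 * V ^ 2 ≤ 6400 * P ^ (2 + 2 * v) := by
    calc (M * N) ^ 2 * V ^ 2 ≤ (16 * P ^ (2 : ℝ)) * (400 * P ^ (2 * v)) := by gcongr
      _ = 6400 * (P ^ (2 : ℝ) * P ^ (2 * v)) := by ring
      _ = _ := by rw [← Real.rpow_add hP0]
  have hinvM : 1 / M ≤ P ^ (-(5 - 5 * γ + 6 * ε + 18 * η)) := by
    rw [Real.rpow_neg hP0.le, ← one_div]
    exact one_div_le_one_div_of_le (Real.rpow_pos_of_pos hP0 _) hM1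
  have hdiag : K * M * (V * N * M) ≤ 80 * y := by
    calc K * M * (V * N * M) = Q * V * (M * N) := by rw [hKM]; ring
      _ ≤ Q * (20 * P ^ v) * (4 * P) := by gcongr
      _ = 80 * (Q * P ^ v * P ^ (1 : ℝ)) := by rw [Real.rpow_one]; ring
      _ = 80 * y := by
          rw [hQ, ← Real.rpow_add hP0, ← Real.rpow_add hP0, hy, hv]
          congr 2
          ring
  have hKVN : K ≤ 2 * (V * N) := by
    have h1 : Q ≤ P := by
      calc Q ≤ P ^ (1 : ℝ) := Real.rpow_le_rpow_of_exponent_le hP (by linarith)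
        _ = P := Real.rpow_one P
    have h2 : K * M ≤ 2 * N * M := by rw [hKM]; linarith
    have h3 : K ≤ 2 * N := le_of_mul_le_mul_right h2 hM0
    nlinarith
  have hcount : K * (V * N + (V * N) ^ 2 / K) ≤ 3 * (V * N) ^ 2 := by
    have h1 : K * (V * N + (V * N) ^ 2 / K) = K * (V * N) + (V * N) ^ 2 := by field_simp
    have h2 : 0 < V * N := by positivity
    rw [h1]
    nlinarith
  have hoff1 : M * (V * N) ^ 2 * Real.sqrt (V * (M * N) ^ γ / K) ≤ 57600 * y := by
    set w := v + ε + 5 * η - (5 - 5 * γ + 6 * ε + 18 * η) with hw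
    have h1 : V * (M * N) ^ γ / K ≤ M ^ 2 * (80 * P ^ w) := by
      calc V * (M * N) ^ γ / K = M ^ 2 * (V * (M * N) ^ γ * (1 / Q) * (1 / M)) := by
            rw [← hKM]; field_simp
        _ ≤ M ^ 2 * ((20 * P ^ v) * (4 * P ^ γ) * P ^ (-(γ - ε - 5 * η)) *
              P ^ (-(5 - 5 * γ + 6 * ε + 18 * η))) := by
            have : 1 / Q = P ^ (-(γ - ε - 5 * η)) := by rw [Real.rpow_neg hP0.le, one_div]
            rw [this]
            gcongr
        _ = M ^ 2 * (80 * (P ^ v * P ^ γ * P ^ (-(γ - ε - 5 * η)) *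
              P ^ (-(5 - 5 * γ + 6 * ε + 18 * η)))) := by ring
        _ = _ := by
            rw [← Real.rpow_add hP0, ← Real.rpow_add hP0, ← Real.rpow_add hP0, hw]
            congr 3
            ring
    have h2 : Real.sqrt (V * (M * N) ^ γ / K) ≤ M * (9 * P ^ (w / 2)) := by
      apply Real.sqrt_le_iff.2
      refine ⟨by positivity, h1.trans ?_⟩
      have : (P ^ (w / 2)) ^ 2 = P ^ w := by
        rw [← Real.rpow_mul_natCast hP0.le]
        congr 1
        push_cast
        ring
      rw [mul_pow, mul_pow, this]
      have : 0 < P ^ w := Real.rpow_pos_of_pos hP0 _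
      gcongr
      norm_num
    calc M * (V * N) ^ 2 * Real.sqrt (V * (M * N) ^ γ / K)
        ≤ M * (V * N) ^ 2 * (M * (9 * P ^ (w / 2))) := by gcongr
      _ = 9 * ((M * N) ^ 2 * V ^ 2) * P ^ (w / 2) := by ring
      _ ≤ 9 * (6400 * P ^ (2 + 2 * v)) * P ^ (w / 2) := by gcongr
      _ = 57600 * (P ^ (2 + 2 * v) * P ^ (w / 2)) := by ring
      _ ≤ 57600 * y := by
          rw [← Real.rpow_add hP0, hy]
          gcongr
          rw [hw, hv]; linarith
  have hoff2 : M * (V * N) ^ 2 * (2 * M * Real.sqrt (N / (M * N) ^ γ)) ≤ 38400 * y := by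
    set w := 1 - γ - (5 - 5 * γ + 6 * ε + 18 * η) with hw
    have h1 : N / (M * N) ^ γ ≤ 8 * P ^ w := by
      calc N / (M * N) ^ γ ≤ N / (P ^ γ / 2) := by gcongr
        _ = 2 * (M * N) * (1 / M) * (1 / P ^ γ) := by field_simp
        _ ≤ 2 * (4 * P) * P ^ (-(5 - 5 * γ + 6 * ε + 18 * η)) * P ^ (-γ) := by
            have : 1 / P ^ γ = P ^ (-γ) := by rw [Real.rpow_neg hP0.le, one_div]
            rw [this]
            gcongr
        _ = 8 * (P ^ (1 : ℝ) * P ^ (-(5 - 5 * γ + 6 * ε + 18 * η)) * P ^ (-γ)) := by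
            rw [Real.rpow_one]; ring
        _ = _ := by
            rw [← Real.rpow_add hP0, ← Real.rpow_add hP0, hw]
            congr 2
            ring
    have h2 : Real.sqrt (N / (M * N) ^ γ) ≤ 3 * P ^ (w / 2) := by
      apply Real.sqrt_le_iff.2
      refine ⟨by positivity, h1.trans ?_⟩
      have : (P ^ (w / 2)) ^ 2 = P ^ w := by
        rw [← Real.rpow_mul_natCast hP0.le]
        congr 1
        push_cast
        ring
      rw [mul_pow, this]
      have : 0 < P ^ w := Real.rpow_pos_of_pos hP0 _
      gcongr
      norm_num
    calc M * (V * N) ^ 2 * (2 * M * Real.sqrt (N / (M * N) ^ γ))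
        ≤ M * (V * N) ^ 2 * (2 * M * (3 * P ^ (w / 2))) := by gcongr
      _ = 6 * ((M * N) ^ 2 * V ^ 2) * P ^ (w / 2) := by ring
      _ ≤ 6 * (6400 * P ^ (2 + 2 * v)) * P ^ (w / 2) := by gcongr
      _ = 38400 * (P ^ (2 + 2 * v) * P ^ (w / 2)) := by ring
      _ ≤ 38400 * y := by
          rw [← Real.rpow_add hP0, hy]
          gcongr
          rw [hw, hv]; linarith
  set s1 := Real.sqrt (V * (M * N) ^ γ / K) with hs1
  set s2 := Real.sqrt (N / (M * N) ^ γ) with hs2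
  have hs10 : 0 ≤ s1 := Real.sqrt_nonneg _
  have hs20 : 0 ≤ s2 := Real.sqrt_nonneg _
  have hbr : K * M * (2 * (V * N) * M + (V * N + (V * N) ^ 2 / K) * (c2 * (s1 + 2 * M * s2))) ≤
      (160 + 300000 * c2) * y := by
    have h1 : K * (V * N + (V * N) ^ 2 / K) * (M * (c2 * (s1 + 2 * M * s2))) ≤
        3 * (V * N) ^ 2 * (M * (c2 * (s1 + 2 * M * s2))) :=
      mul_le_mul_of_nonneg_right hcount (by positivity)
    have h2 : 3 * (V * N) ^ 2 * (M * (c2 * (s1 + 2 * M * s2))) =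
        3 * c2 * (M * (V * N) ^ 2 * s1 + M * (V * N) ^ 2 * (2 * M * s2)) := by ring
    have h3 : 3 * c2 * (M * (V * N) ^ 2 * s1 + M * (V * N) ^ 2 * (2 * M * s2)) ≤
        3 * c2 * (57600 * y + 38400 * y) := by gcongr
    have h4 : 0 ≤ c2 * y := by positivity
    linarith
  calc M * (4 * K) * (c1 * Lg * (2 * (V * N) * M + (V * N + (V * N) ^ 2 / K) *
        (c2 * (s1 + 2 * M * s2))))
      = 4 * c1 * Lg * (K * M * (2 * (V * N) * M + (V * N + (V * N) ^ 2 / K) *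
        (c2 * (s1 + 2 * M * s2)))) := by ring
    _ ≤ 4 * c1 * Lg * ((160 + 300000 * c2) * y) := by gcongr
    _ ≤ 4 * c1 * (W * P ^ ε) * ((160 + 300000 * c2) * y) := by gcongr
    _ = 4 * c1 * W * (160 + 300000 * c2) * (P ^ ε * y) := by ring
    _ = _ := by
        rw [hy, ← Real.rpow_add hP0]
        congr 2
        ring

theorem exists_bilinear_dyN_le {γ ε η : ℝ} (hγ0 : 0 < γ) (hγ1 : γ < 1) (hε : 0 < ε)
    (hη : 0 < η) : ∃ C > (0 : ℝ), ∀ P M N V : ℝ, 1 ≤ P → 1 ≤ M → 1 ≤ N → 1 ≤ V →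
    P ^ (5 - 5 * γ + 6 * ε + 18 * η) ≤ M → M ≤ P ^ (γ - 2 * ε - 6 * η) →
    V ≤ 20 * P ^ (1 - γ + η) → ∀ a d : ℕ → ℂ, (∀ m ∈ dyN M, ‖a m‖ ≤ 1) →
    (∀ h ∈ dyN V, ‖d h‖ ≤ 1) →
    ‖∑ m ∈ dyN M, ∑ n ∈ (dyN N).filter
        (fun n => P / 2 ≤ ((m * n : ℕ) : ℝ) ∧ ((m * n : ℕ) : ℝ) < P),
        ∑ h ∈ dyN V, a m * d h * e ((h : ℝ) * ((m : ℝ) * (n : ℝ)) ^ γ)‖ ≤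
      C * P ^ (1 - 2 * η) := by
  set c1 := 2 * (1 + 1 / γ) with hc1
  set c2 := 504 * (1 + 3 / Real.sqrt (γ * (1 - γ))) with hc2
  set W := 3 * (5 + (1 - γ + η)) * (1 + 2 / ε) ^ 2 with hW
  have hg : 0 < Real.sqrt (γ * (1 - γ)) := Real.sqrt_pos.2 (mul_pos hγ0 (by linarith))
  have hv : 0 < 1 - γ + η := by linarith
  have hc10 : 0 < c1 := by positivity
  have hc20 : 0 < c2 := by positivity
  have hW0 : 0 < W := by positivity
  set E := 4 * c1 * W * (160 + 300000 * c2) with hE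
  have hE0 : 0 < E := by positivity
  refine ⟨Real.sqrt E, Real.sqrt_pos.2 hE0, ?_⟩
  intro P M N V hP hM hN hV hM1 hM2 hV2 a d ha hd
  have hP0 : 0 < P := by linarith
  have hM0 : 0 < M := by linarith
  by_cases hne : ∃ m ∈ dyN M, ∃ n ∈ dyN N, P / 2 ≤ ((m * n : ℕ) : ℝ) ∧ ((m * n : ℕ) : ℝ) < P
  · obtain ⟨m, hm, n, hn, h1, h2⟩ := hne
    obtain ⟨m1, m2⟩ := mem_dyN.1 hm
    obtain ⟨n1, n2⟩ := mem_dyN.1 hn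
    push_cast at h1 h2
    have hMN1 : P / 2 ≤ M * N :=
      h1.trans (mul_le_mul m2.le n2.le (Nat.cast_nonneg _) hM0.le)
    have hMN2 : M * N ≤ 4 * P := by
      have : M / 2 * (N / 2) ≤ (m : ℝ) * n :=
        mul_le_mul m1 n1 (by linarith) (Nat.cast_nonneg _)
      linarith
    have hN4 : N ≤ 4 * P := by nlinarith
    have hK : 1 ≤ P ^ (γ - ε - 5 * η) / M := by
      rw [le_div_iff₀ hM0, one_mul]
      exact hM2.trans (Real.rpow_le_rpow_of_exponent_le hP (by linarith))
    have hb := norm_sq_bilinear_dyN_le (X := P) hγ0 hγ1 hM hN hV hK a d ha hd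
    have hlogs := log_product_le hε hv.le hP hN hV hN4 hV2
    have hf := grouped_bound_le (c1 := c1) (c2 := c2) (W := W) hγ0 hγ1 hε hη hP hM hN hV hM1 hV2
      hMN1 hMN2 hc10.le hc20.le (mul_nonneg (by linarith [Real.log_nonneg hV])
        (by linarith [Real.log_nonneg hN])) hlogs rfl
    refine (Real.le_sqrt_of_sq_le (hb.trans hf)).trans (le_of_eq ?_)
    rw [Real.sqrt_mul hE0.le]
    congr 1
    rw [Real.sqrt_eq_rpow, ← Real.rpow_mul hP0.le]
    congr 1
    ring
  · have hz : ∀ m ∈ dyN M, (dyN N).filter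
        (fun n => P / 2 ≤ ((m * n : ℕ) : ℝ) ∧ ((m * n : ℕ) : ℝ) < P) = ∅ := fun m hm =>
      filter_eq_empty_iff.2 fun n hn h => hne ⟨m, hm, n, hn, h⟩
    rw [sum_congr rfl fun m hm => by rw [hz m hm, sum_empty]]
    simp only [sum_const_zero, norm_zero]
    positivity

theorem sum_dyZ_eq {V : ℝ} (hV : 1 ≤ V) (f : ℤ → ℂ) :
    ∑ h ∈ dyZ V, f h = ∑ h ∈ dyN V, f h + ∑ h ∈ dyN V, f (-(h : ℤ)) := by
  have hmem : ∀ l : ℤ, l ∈ dyZ V ↔ l.natAbs ∈ dyN V := by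
    intro l
    have hcast : ((l.natAbs : ℕ) : ℝ) = |(l : ℝ)| := by
      rw [Nat.cast_natAbs, Int.cast_abs]
    rw [mem_dyN, hcast]
    simp only [dyZ, mem_filter, mem_Icc]
    constructor
    · exact fun h => h.2.2
    · intro h
      have h3 : l.natAbs < ⌈V⌉₊ := Nat.lt_ceil.2 (hcast ▸ h.2)
      refine ⟨by omega, ?_, h⟩
      rintro rfl
      norm_num at h
      linarith
  rw [← sum_filter_add_sum_filter_not (dyZ V) (fun l => 0 < l)]
  congr 1
  · refine sum_nbij' (fun l => l.natAbs) (fun h => (h : ℤ)) ?_ ?_ ?_ ?_ ?_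
    · intro l hl
      exact (hmem l).1 (mem_filter.1 hl).1
    · intro h hh
      refine mem_filter.2 ⟨(hmem _).2 (by simpa using hh), ?_⟩
      exact_mod_cast pos_of_mem_dyN hV hh
    · intro l hl
      have := (mem_filter.1 hl).2
      omega
    · intro h _
      simp
    · intro l hl
      have := (mem_filter.1 hl).2
      congr 1
      omega
  · refine sum_nbij' (fun l => l.natAbs) (fun h => -(h : ℤ)) ?_ ?_ ?_ ?_ ?_
    · intro l hl
      exact (hmem l).1 (mem_filter.1 hl).1
    · intro h hh
      refine mem_filter.2 ⟨(hmem _).2 (by simpa using hh), ?_⟩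
      omega
    · intro l hl
      have := (mem_filter.1 hl).2
      omega
    · intro h _
      simp
    · intro l hl
      have := (mem_filter.1 hl).2
      congr 1
      omega

/-- The bilinear estimate for arbitrary positive `ε` and `η`, with frequencies of both signs. -/
theorem exists_bilinear_dyZ_le {γ ε η : ℝ} (hγ0 : 0 < γ) (hγ1 : γ < 1) (hε : 0 < ε)
    (hη : 0 < η) : ∃ C > (0 : ℝ), ∀ P M N V : ℝ, 1 ≤ P → 1 ≤ M → 1 ≤ N → 1 ≤ V →
    P ^ (5 - 5 * γ + 6 * ε + 18 * η) ≤ M → M ≤ P ^ (γ - 2 * ε - 6 * η) →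
    V ≤ 20 * P ^ (1 - γ + η) → ∀ (a : ℕ → ℂ) (d : ℤ → ℂ), (∀ m ∈ dyN M, ‖a m‖ ≤ 1) →
    (∀ h ∈ dyZ V, ‖d h‖ ≤ 1) →
    ‖∑ m ∈ dyN M, ∑ n ∈ (dyN N).filter
        (fun n => P / 2 ≤ ((m * n : ℕ) : ℝ) ∧ ((m * n : ℕ) : ℝ) < P),
        ∑ h ∈ dyZ V, a m * d h * e ((h : ℝ) * ((m : ℝ) * (n : ℝ)) ^ γ)‖ ≤
      C * P ^ (1 - 2 * η) := by
  obtain ⟨C, hC, hbound⟩ := exists_bilinear_dyN_le hγ0 hγ1 hε hη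
  refine ⟨2 * C, by positivity, ?_⟩
  intro P M N V hP hM hN hV hM1 hM2 hV2 a d ha hd
  have hsign : ∀ l : ℤ, l.natAbs ∈ dyN V → ‖d l‖ ≤ 1 := by
    intro l hl
    apply hd
    have hcast : ((l.natAbs : ℕ) : ℝ) = |(l : ℝ)| := by
      rw [Nat.cast_natAbs, Int.cast_abs]
    have h2 := mem_dyN.1 hl
    have h3 : l.natAbs < ⌈V⌉₊ := Nat.lt_ceil.2 h2.2
    have h4 := pos_of_mem_dyN hV hl
    rw [hcast] at h2
    exact mem_filter.2 ⟨mem_Icc.2 (by omega), by omega, h2⟩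
  have hpos := hbound P M N V hP hM hN hV hM1 hM2 hV2 a (fun h => d h) ha
    (fun h hh => hsign _ (by simpa using hh))
  have hneg := hbound P M N V hP hM hN hV hM1 hM2 hV2 (fun m => (starRingEnd ℂ) (a m))
    (fun h => (starRingEnd ℂ) (d (-(h : ℤ)))) (fun m hm => by rw [RCLike.norm_conj]; exact ha m hm)
    (fun h hh => by rw [RCLike.norm_conj]; exact hsign _ (by simpa using hh))
  rw [← RCLike.norm_conj] at hneg
  simp only [map_sum, map_mul, Complex.conj_conj, conj_e] at hneg
  simp only [sum_dyZ_eq hV, sum_add_distrib, Int.cast_natCast, Int.cast_neg, neg_mul]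
  refine (norm_add_le _ _).trans ?_
  linarith

theorem S2_large (c γ : ℝ) (hc1 : 1 < c) (hc2 : c < 9/8) (hγ : γ = 1/c) :
    ∃ ε > (0:ℝ), ∃ η > (0:ℝ), ∃ C > (0:ℝ), ∃ X₀ > (0:ℝ), ∀ X : ℕ, X₀ ≤ (X:ℝ) →
    ∀ M N V : ℝ, 1 ≤ M → 1 ≤ N → 1 ≤ V →
    (X:ℝ)^(5-5*γ+6*ε+18*η) ≤ M → M ≤ (X:ℝ)^(γ-2*ε-6*η) → V ≤ (⌊10 * (X:ℝ)^(1-γ+η) / γ⌋₊ : ℝ) →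
    ∀ am : ℕ → ℂ, ∀ dh : ℤ → ℂ,
    (∀ m ∈ dyN M, ‖am m‖ ≤ 1) → (∀ h ∈ dyZ V, ‖dh h‖ ≤ 1) →
    ‖∑ m ∈ dyN M, ∑ n ∈ (dyN N).filter (fun n => (X:ℝ)/2 ≤ ((m*n:ℕ):ℝ) ∧ ((m*n:ℕ):ℝ) < (X:ℝ)),
        ∑ h ∈ dyZ V, am m * dh h * e ((h:ℝ) * ((m:ℝ)*(n:ℝ))^γ)‖ ≤ C * (X:ℝ)^(1-2*η) := by
  have hc0 : 0 < c := by linarith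
  have hγ1 : γ < 1 := by rw [hγ, div_lt_one hc0]; exact hc1
  have hγ2 : 8 / 9 < γ := by rw [hγ, lt_div_iff₀ hc0]; linarith
  have hγ0 : 0 < γ := by linarith
  -- With this choice the range for `M` is nonempty: `5 - 5 * γ + 24 * η < γ - 8 * η`.
  obtain ⟨η, hη⟩ : ∃ η, η = (6 * γ - 5) / 100 := ⟨_, rfl⟩
  have hη0 : 0 < η := by rw [hη]; linarith
  obtain ⟨C, hC, hbound⟩ := exists_bilinear_dyZ_le hγ0 hγ1 hη0 hη0
  refine ⟨η, hη0, η, hη0, C, hC, 1, one_pos, ?_⟩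
  intro X hX M N V hM hN hV hM1 hM2 hV2 am dh ham hdh
  refine hbound X M N V hX hM hN hV hM1 hM2 (hV2.trans ?_) am dh ham hdh
  have hp : 0 < (X : ℝ) ^ (1 - γ + η) := Real.rpow_pos_of_pos (by linarith) _
  refine (Nat.floor_le (by positivity)).trans ?_
  rw [div_le_iff₀ hγ0]
  nlinarith
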